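/- For every y with 0 < y < 1, ∫_0^y f(-q)^4 · q^{-5/6} dq = 6·R(y)^{5/6} · F₁(1/6; 1/6, 1/6; 7/6; ((11 − 5√5)/2)·R(y)^5, ((11 + 5√5)/2)·R(y)^5), where F₁ is the Appell double hypergeometric series. -/

import Mathlib

open MeasureTheory Real

/-- Euler's product `f(-q) = ∏_{n=1}^∞ (1 - qⁿ)`. -/
noncomputable def eulerF (q : ℝ) : ℝ := ∏' n : ℕ, (1 - q ^ (n + 1))

/-- `y(q) = f(-q^{1/5}) / (q^{1/5} · f(-q⁵))`. -/
noncomputable def yF (q : ℝ) : ℝ :=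
  eulerF (q ^ ((1 : ℝ) / 5)) / (q ^ ((1 : ℝ) / 5) * eulerF (q ^ 5))

/-- The Rogers–Ramanujan continued fraction, recovered from `y(q)` via
`1/R - 1 - R = y`, `0 < R < 1`. -/
noncomputable def RRcf (q : ℝ) : ℝ :=
  (Real.sqrt (yF q ^ 2 + 2 * yF q + 5) - yF q - 1) / 2

/-- The Appell double hypergeometric series `F₁(a; b₁, b₂; c; x, y)`. -/
noncomputable def appellF1 (a b₁ b₂ c x y : ℝ) : ℝ :=
  ∑' p : ℕ × ℕ,
    ((ascPochhammer ℝ (p.1 + p.2)).eval a * (ascPochhammer ℝ p.1).eval b₁ *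
        (ascPochhammer ℝ p.2).eval b₂ / (ascPochhammer ℝ (p.1 + p.2)).eval c) *
      x ^ p.1 * y ^ p.2 / (p.1.factorial * p.2.factorial)

open Filter Topology

/-- The finite product `(q; q)_n`. -/
noncomputable def qP (q : ℂ) (n : ℕ) : ℂ := ∏ k ∈ Finset.range n, (1 - q ^ (k + 1))

/-- Euler's product as a function of a complex variable. -/
noncomputable def cF (q : ℂ) : ℂ := ∏' n : ℕ, (1 - q ^ (n + 1))

lemma one_sub_pow_ne_zero {q : ℂ} (hq : ‖q‖ < 1) (n : ℕ) : 1 - q ^ (n + 1) ≠ 0 := by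
  intro h
  have h1 : ‖q ^ (n + 1)‖ = 1 := by rw [← sub_eq_zero.mp h]; simp
  rw [norm_pow] at h1
  exact (pow_lt_one₀ (norm_nonneg q) hq (Nat.succ_ne_zero n)).ne h1

lemma qP_ne_zero {q : ℂ} (hq : ‖q‖ < 1) (n : ℕ) : qP q n ≠ 0 :=
  Finset.prod_ne_zero_iff.mpr fun k _ ↦ one_sub_pow_ne_zero hq k

lemma qP_succ (q : ℂ) (n : ℕ) : qP q (n + 1) = qP q n * (1 - q ^ (n + 1)) :=
  Finset.prod_range_succ _ _

lemma cF_ne_zero {q : ℂ} (hq : ‖q‖ < 1) : cF q ≠ 0 := by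
  have := tprod_one_add_ne_zero_of_summable (f := fun n : ℕ ↦ -q ^ (n + 1))
    (fun i ↦ by simpa [sub_eq_add_neg] using one_sub_pow_ne_zero hq i) (by
      simpa using (summable_nat_add_iff 1).mpr (summable_geometric_of_lt_one (norm_nonneg _) hq))
  simpa [cF, sub_eq_add_neg] using this

lemma tendsto_qP {q : ℂ} (hq : ‖q‖ < 1) : Tendsto (qP q) atTop (𝓝 (cF q)) :=
  (ModularForm.multipliable_one_sub_pow hq).hasProd.tendsto_prod_nat

lemma exists_norm_qP_le {q : ℂ} (hq : ‖q‖ < 1) : ∃ C, ∀ n, ‖qP q n‖ ≤ C := by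
  obtain ⟨C, hC⟩ := (tendsto_qP hq).norm.bddAbove_range
  exact ⟨C, fun n ↦ hC ⟨n, rfl⟩⟩

lemma exists_norm_qP_inv_le {q : ℂ} (hq : ‖q‖ < 1) : ∃ C, ∀ n, ‖(qP q n)⁻¹‖ ≤ C := by
  obtain ⟨C, hC⟩ := ((tendsto_qP hq).inv₀ (cF_ne_zero hq)).norm.bddAbove_range
  exact ⟨C, fun n ↦ hC ⟨n, rfl⟩⟩

/-- Gauss's `q`-binomial theorem. -/
lemma sum_qbinom {q : ℂ} (hq : ‖q‖ < 1) (N : ℕ) (x : ℂ) :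
    ∑ j ∈ Finset.range (N + 1), q ^ (j.choose 2) * (qP q N / (qP q j * qP q (N - j))) * x ^ j
      = ∏ k ∈ Finset.range N, (1 + x * q ^ k) := by
  induction N with
  | zero => simp [qP]
  | succ N ih =>
    rw [Finset.prod_range_succ, ← ih, mul_add, mul_one, Finset.sum_mul]
    rw [Finset.sum_range_succ', Finset.sum_range_succ]
    rw [Finset.sum_range_succ' (n := N)]
    rw [Finset.sum_range_succ (n := N) (f := fun j ↦ _ * (x * q ^ N))]
    have key : ∀ j ∈ Finset.range N,
        q ^ ((j + 1).choose 2) * (qP q (N + 1) / (qP q (j + 1) * qP q (N + 1 - (j + 1))))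
          * x ^ (j + 1)
        = q ^ ((j + 1).choose 2) * (qP q N / (qP q (j + 1) * qP q (N - (j + 1)))) * x ^ (j + 1)
          + q ^ (j.choose 2) * (qP q N / (qP q j * qP q (N - j))) * x ^ j * (x * q ^ N) := by
      intro j hj
      obtain ⟨m, rfl⟩ : ∃ m, N = j + 1 + m := ⟨N - (j + 1), by
        have := Finset.mem_range.mp hj; omega⟩
      rw [show j + 1 + m + 1 - (j + 1) = m + 1 by omega, show j + 1 + m - (j + 1) = m by omega,
        show j + 1 + m - j = m + 1 by omega, qP_succ q (j + 1 + m), qP_succ q j, qP_succ q m]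
      have h1 := qP_ne_zero hq j
      have h2 := qP_ne_zero hq m
      have h3 := one_sub_pow_ne_zero hq j
      have h4 := one_sub_pow_ne_zero hq m
      have h5 : (j + 1).choose 2 = j.choose 2 + j := by
        rw [Nat.choose_succ_succ' j 1]; simp [add_comm]
      rw [h5]
      field_simp
      ring
    rw [Finset.sum_congr rfl key, Finset.sum_add_distrib]
    have h0 : qP q 0 = 1 := by simp [qP]
    have hN := qP_ne_zero hq N
    have hN1 := qP_ne_zero hq (N + 1)
    have h5 : (N + 1).choose 2 = N.choose 2 + N := by
      rw [Nat.choose_succ_succ' N 1]; simp [add_comm]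
    simp only [h0, h5, Nat.sub_self, Nat.sub_zero, mul_one, one_mul, pow_zero, Nat.choose_zero_succ,
      div_self hN, div_self hN1]
    ring

/-- The exponent `i (i + 1) / 2` of Jacobi's identity. -/
def tri (i : ℤ) : ℕ := (i * (i + 1) / 2).toNat

lemma two_mul_tri (i : ℤ) : 2 * (tri i : ℤ) = i * (i + 1) := by
  have h : 0 ≤ i * (i + 1) := by
    rcases le_or_gt 0 i with h | h <;> nlinarith
  have he : Even (i * (i + 1)) := Int.even_mul_succ_self i
  rw [tri, Int.toNat_of_nonneg (by positivity)]
  exact Int.two_mul_ediv_two_of_even he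

lemma natAbs_le_tri (i : ℤ) : i.natAbs ≤ tri i + 1 := by
  have := two_mul_tri i
  have h : (i.natAbs : ℤ) ≤ tri i + 1 := by
    rw [Int.natCast_natAbs]
    rcases le_or_gt 0 i with h | h
    · rw [abs_of_nonneg h]; nlinarith
    · rw [abs_of_neg h]; nlinarith
  exact_mod_cast h

lemma summable_natAbs_mul_pow_tri {r : ℝ} (hr0 : 0 < r) (hr : r < 1) :
    Summable fun i : ℤ ↦ (i.natAbs : ℝ) * r ^ tri i := by
  have h : Summable fun n : ℕ ↦ (n : ℝ) * r ^ n := by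
    simpa using summable_pow_mul_geometric_of_norm_lt_one 1 (r := r)
      (by rwa [Real.norm_of_nonneg hr0.le])
  have h2 : Summable fun i : ℤ ↦ r⁻¹ * ((i.natAbs : ℝ) * r ^ i.natAbs) := by
    apply Summable.mul_left
    apply Summable.of_nat_of_neg <;> simpa using h
  refine h2.of_nonneg_of_le (fun i ↦ by positivity) fun i ↦ ?_
  have : r ^ (tri i + 1) ≤ r ^ i.natAbs := pow_le_pow_of_le_one hr0.le hr.le (natAbs_le_tri i)
  rw [show r⁻¹ * ((i.natAbs : ℝ) * r ^ i.natAbs) = i.natAbs * (r⁻¹ * r ^ i.natAbs) by ring]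
  gcongr
  rw [le_inv_mul_iff₀ hr0]
  calc r * r ^ tri i = r ^ (tri i + 1) := by ring
    _ ≤ _ := this

/-- Finite form of Jacobi's identity. -/
lemma finite_jacobi {q : ℂ} (hq0 : q ≠ 0) (hq : ‖q‖ < 1) (n : ℕ) :
    ∑ j ∈ Finset.range (2 * n + 2), (-1 : ℂ) ^ ((j : ℤ) - n - 1) * ((j : ℤ) - n - 1 : ℤ) *
      q ^ tri ((j : ℤ) - n - 1) * (qP q (2 * n + 1) / (qP q j * qP q (2 * n + 1 - j)))
      = qP q n ^ 2 := by
  set x₀ : ℂ := -(q ^ n)⁻¹ with hx₀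
  have hqn : q ^ n ≠ 0 := pow_ne_zero _ hq0
  set c : ℕ → ℂ := fun j ↦ q ^ (j.choose 2) * (qP q (2 * n + 1) / (qP q j * qP q (2 * n + 1 - j)))
    with hc
  have hfun : ∀ x, ∑ j ∈ Finset.range (2 * n + 2), c j * x ^ j
      = (1 + x * q ^ n) * ((∏ k ∈ Finset.range n, (1 + x * q ^ k)) *
        ∏ k ∈ Finset.range n, (1 + x * q ^ (n + 1 + k))) := by
    intro x
    have := sum_qbinom hq (2 * n + 1) x
    rw [show 2 * n + 1 = n + 1 + n by ring, Finset.prod_range_add, Finset.prod_range_succ] at this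
    rw [show 2 * n + 2 = n + 1 + n + 1 by ring]
    simp only [hc]
    rw [show 2 * n + 1 = n + 1 + n by ring, this]
    ring
  have hroot : 1 + x₀ * q ^ n = 0 := by rw [hx₀]; field_simp; ring
  have h0 : ∑ j ∈ Finset.range (2 * n + 2), c j * x₀ ^ j = 0 := by rw [hfun, hroot, zero_mul]
  have hP1 : ∏ k ∈ Finset.range n, (1 + x₀ * q ^ (n + 1 + k)) = qP q n := by
    refine Finset.prod_congr rfl fun k _ ↦ ?_
    rw [hx₀]; field_simp; ring
  have hP2 : ∏ k ∈ Finset.range n, (1 + x₀ * q ^ k) = (-1) ^ n * (q ^ tri n)⁻¹ * qP q n := by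
    have ht : q ^ tri n = ∏ k ∈ Finset.range n, q ^ (k + 1) := by
      rw [Finset.prod_pow_eq_pow_sum]
      congr 1
      have h1 := two_mul_tri n
      have h2 := Finset.sum_range_id_mul_two (n + 1)
      rw [Finset.sum_range_succ'] at h2
      simp only [add_zero, Nat.add_sub_cancel] at h2
      zify at h2 ⊢
      linarith
    rw [ht, ← Finset.prod_range_reflect, ← Finset.prod_inv_distrib]
    have : (-1 : ℂ) ^ n = ∏ k ∈ Finset.range n, (-1) := by simp
    rw [this, qP, ← Finset.prod_mul_distrib, ← Finset.prod_mul_distrib]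
    refine Finset.prod_congr rfl fun k hk ↦ ?_
    have hk := Finset.mem_range.mp hk
    obtain ⟨m, rfl⟩ : ∃ m, n = k + 1 + m := ⟨n - (k + 1), by omega⟩
    rw [hx₀, show k + 1 + m - 1 - k = m by omega]
    field_simp
    ring
  have hder : ∑ j ∈ Finset.range (2 * n + 2), c j * (j * x₀ ^ (j - 1))
      = q ^ n * ((-1) ^ n * (q ^ tri n)⁻¹ * qP q n * qP q n) := by
    have h1 : HasDerivAt (fun x : ℂ ↦ ∑ j ∈ Finset.range (2 * n + 2), c j * x ^ j)
        (∑ j ∈ Finset.range (2 * n + 2), c j * (j * x₀ ^ (j - 1))) x₀ :=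
      HasDerivAt.fun_sum fun j _ ↦ (hasDerivAt_pow j x₀).const_mul _
    have h2 : DifferentiableAt ℂ (fun x : ℂ ↦ (∏ k ∈ Finset.range n, (1 + x * q ^ k)) *
        ∏ k ∈ Finset.range n, (1 + x * q ^ (n + 1 + k))) x₀ := by fun_prop
    have h3 := (((hasDerivAt_id x₀).mul_const (q ^ n)).const_add 1).mul h2.hasDerivAt
    have h4 := h1.unique (h3.congr_of_eventuallyEq (Eventually.of_forall fun x ↦ by
      simpa using hfun x))
    rw [h4]
    simp only [id, hroot, zero_mul, add_zero, one_mul, hP1, hP2]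
  have hjc : ∀ j : ℕ, c j * (j * x₀ ^ (j - 1)) * x₀ = j * (c j * x₀ ^ j) := by
    intro j
    rcases j with _ | j
    · simp
    · simp only [Nat.add_sub_cancel]; ring
  have hsum : ∑ j ∈ Finset.range (2 * n + 2), ((j : ℂ) - n - 1) * (c j * x₀ ^ j)
      = x₀ * (q ^ n * ((-1) ^ n * (q ^ tri n)⁻¹ * qP q n * qP q n)) := by
    rw [← hder, mul_comm x₀, Finset.sum_mul]
    simp only [hjc, sub_mul, Finset.sum_sub_distrib, ← Finset.mul_sum]
    rw [h0]
    ring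
  have hqt : q ^ tri n ≠ 0 := pow_ne_zero _ hq0
  have hterm : ∀ j ∈ Finset.range (2 * n + 2), (-1 : ℂ) ^ ((j : ℤ) - n - 1) *
      ((j : ℤ) - n - 1 : ℤ) * q ^ tri ((j : ℤ) - n - 1) *
        (qP q (2 * n + 1) / (qP q j * qP q (2 * n + 1 - j)))
      = -(-1) ^ n * q ^ tri n * (((j : ℂ) - n - 1) * (c j * x₀ ^ j)) := by
    intro j _
    have he : tri ((j : ℤ) - n - 1) + n * j = tri n + j.choose 2 := by
      have h1 := two_mul_tri ((j : ℤ) - n - 1)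
      have h2 := two_mul_tri n
      have h3 : ((2 * j.choose 2 : ℕ) : ℤ) = j * (j - 1) := by
        rw [Nat.choose_two_right, Nat.two_mul_div_two_of_even (Nat.even_mul_pred_self j)]
        rcases j with _ | j <;> simp
      zify
      push_cast at h3
      linarith
    have hp : q ^ tri ((j : ℤ) - n - 1) = q ^ tri n * q ^ j.choose 2 * (q ^ (n * j))⁻¹ := by
      rw [eq_mul_inv_iff_mul_eq₀ (pow_ne_zero _ hq0), ← pow_add, ← pow_add, he]
    have hs : (-1 : ℂ) ^ ((j : ℤ) - n - 1) = -((-1) ^ n * (-1) ^ j) := by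
      rw [zpow_sub₀ (by norm_num), zpow_sub₀ (by norm_num)]
      simp only [zpow_natCast, zpow_one]
      rcases neg_one_pow_eq_or ℂ n with h | h <;> rw [h] <;> ring
    have hx : x₀ ^ j = (-1) ^ j * (q ^ (n * j))⁻¹ := by
      rw [hx₀, neg_pow, inv_pow, ← pow_mul]
    rw [hp, hs, hx]
    simp only [hc]
    push_cast
    ring
  rw [Finset.sum_congr rfl hterm, ← Finset.mul_sum, hsum, hx₀]
  have h1 : (-1 : ℂ) ^ n * (-1) ^ n = 1 := by rw [← mul_pow]; simp
  field_simp
  linear_combination (qP q n) ^ 2 * h1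

lemma hasSum_finite_jacobi {q : ℂ} (hq0 : q ≠ 0) (hq : ‖q‖ < 1) (n : ℕ) :
    HasSum (fun i : ℤ ↦ if -(n : ℤ) - 1 ≤ i ∧ i ≤ n then (-1 : ℂ) ^ i * i * q ^ tri i *
      (qP q (2 * n + 1) / (qP q (n + 1 + i).toNat * qP q (n - i).toNat)) else 0)
      (qP q n ^ 2) := by
  rw [← finite_jacobi hq0 hq n]
  have hinj : Set.InjOn (fun j : ℕ ↦ (j : ℤ) - n - 1) (Finset.range (2 * n + 2)) :=
    fun a _ b _ h ↦ by simp only at h; omega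
  have h := hasSum_sum_of_ne_finset_zero (L := .unconditional ℤ) (f := fun i : ℤ ↦ if -(n : ℤ) - 1 ≤ i ∧ i ≤ n then
      (-1 : ℂ) ^ i * i * q ^ tri i *
      (qP q (2 * n + 1) / (qP q (n + 1 + i).toNat * qP q (n - i).toNat)) else 0)
      (s := (Finset.range (2 * n + 2)).image (fun j : ℕ ↦ (j : ℤ) - n - 1)) (by
        intro i hi
        rw [if_neg]
        rintro ⟨h1, h2⟩
        refine hi (Finset.mem_image.mpr ⟨(i + n + 1).toNat, ?_, ?_⟩)
        · rw [Finset.mem_range]; omega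
        · omega)
  rw [Finset.sum_image hinj] at h
  convert h using 1
  refine Finset.sum_congr rfl fun j hj ↦ ?_
  have hj := Finset.mem_range.mp hj
  rw [if_pos ⟨by omega, by omega⟩]
  rw [show ((n : ℤ) + 1 + ((j : ℤ) - n - 1)).toNat = j by omega,
    show ((n : ℤ) - ((j : ℤ) - n - 1)).toNat = 2 * n + 1 - j by omega]

/-- Jacobi's identity for the cube of Euler's product. -/
lemma hasSum_cF_pow_three {q : ℂ} (hq0 : q ≠ 0) (hq : ‖q‖ < 1) :
    HasSum (fun i : ℤ ↦ (-1 : ℂ) ^ i * i * q ^ tri i) (cF q ^ 3) := by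
  have hr0 : 0 < ‖q‖ := norm_pos_iff.mpr hq0
  have hnorm : ∀ i : ℤ, ‖(-1 : ℂ) ^ i * i * q ^ tri i‖ = i.natAbs * ‖q‖ ^ tri i := by
    intro i
    rw [norm_mul, norm_mul, norm_zpow, norm_neg, norm_one, one_zpow, one_mul, norm_pow,
      Complex.norm_intCast, Nat.cast_natAbs, Int.cast_abs]
  have hsummable : Summable (fun i : ℤ ↦ (-1 : ℂ) ^ i * i * q ^ tri i) := by
    apply Summable.of_norm
    simpa only [hnorm] using summable_natAbs_mul_pow_tri hr0 hq
  obtain ⟨C, hC⟩ := exists_norm_qP_le hq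
  obtain ⟨C', hC'⟩ := exists_norm_qP_inv_le hq
  have hC0 : 0 ≤ C := (norm_nonneg _).trans (hC 0)
  have hC0' : 0 ≤ C' := (norm_nonneg _).trans (hC' 0)
  have hlim := tendsto_tsum_of_dominated_convergence (𝓕 := atTop)
    (f := fun (n : ℕ) (i : ℤ) ↦ if -(n : ℤ) - 1 ≤ i ∧ i ≤ n then (-1 : ℂ) ^ i * i * q ^ tri i *
      (qP q (2 * n + 1) / (qP q (n + 1 + i).toNat * qP q (n - i).toNat)) else 0)
    (g := fun i ↦ (-1 : ℂ) ^ i * i * q ^ tri i * (cF q / (cF q * cF q)))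
    (bound := fun i ↦ i.natAbs * ‖q‖ ^ tri i * (C * (C' * C')))
    ((summable_natAbs_mul_pow_tri hr0 hq).mul_right _)
    (by
      intro i
      have hev : ∀ᶠ n : ℕ in atTop, -(n : ℤ) - 1 ≤ i ∧ i ≤ n := by
        filter_upwards [eventually_ge_atTop i.natAbs] with n hn
        omega
      have hl : Tendsto (fun n : ℕ ↦ (-1 : ℂ) ^ i * i * q ^ tri i *
          (qP q (2 * n + 1) / (qP q (n + 1 + i).toNat * qP q (n - i).toNat))) atTop
          (𝓝 ((-1 : ℂ) ^ i * i * q ^ tri i * (cF q / (cF q * cF q)))) := by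
        have ht : ∀ f : ℕ → ℕ, (∀ n, n ≤ f n + i.natAbs) →
            Tendsto (fun n ↦ qP q (f n)) atTop (𝓝 (cF q)) := by
          intro f hf
          refine (tendsto_qP hq).comp (tendsto_atTop.mpr fun b ↦ ?_)
          filter_upwards [eventually_ge_atTop (b + i.natAbs)] with n hn
          have := hf n
          omega
        refine ((ht _ fun n ↦ ?_).div ((ht _ fun n ↦ ?_).mul (ht _ fun n ↦ ?_))
          (mul_ne_zero (cF_ne_zero hq) (cF_ne_zero hq))).const_mul _ <;> omega
      refine hl.congr' ?_
      filter_upwards [hev] with n hn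
      rw [if_pos hn])
    (by
      refine Eventually.of_forall fun n i ↦ ?_
      split_ifs
      · rw [norm_mul, hnorm, div_eq_mul_inv, mul_inv, norm_mul, norm_mul]
        gcongr
        · exact hC _
        · exact hC' _
        · exact hC' _
      · rw [norm_zero]; positivity)
  simp only [(hasSum_finite_jacobi hq0 hq _).tsum_eq] at hlim
  have h := tendsto_nhds_unique hlim ((tendsto_qP hq).pow 2)
  have hF := cF_ne_zero hq
  rw [tsum_mul_right] at h
  have h3 : ∑' i : ℤ, (-1 : ℂ) ^ i * i * q ^ tri i = cF q ^ 3 := by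
    field_simp at h
    linear_combination h
  exact h3 ▸ hsummable.hasSum

lemma natAbs_le_pentagonal (k : ℤ) : k.natAbs ≤ pentagonal k := by
  have h := two_mul_natCast_pentagonal k
  have h : (k.natAbs : ℤ) ≤ pentagonal k := by
    rw [Int.natCast_natAbs]
    rcases le_or_gt k 0 with h | h
    · rw [abs_of_nonpos h]; nlinarith
    · rw [abs_of_pos h]; nlinarith
  exact_mod_cast h

lemma summable_pow_pentagonal {q : ℂ} (hq : ‖q‖ < 1) :
    Summable fun k : ℤ ↦ (-1 : ℂ) ^ k * q ^ pentagonal k := by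
  apply Summable.of_norm
  have h := summable_geometric_of_lt_one (norm_nonneg q) hq
  have h2 : Summable fun i : ℤ ↦ ‖q‖ ^ i.natAbs := by
    apply Summable.of_nat_of_neg <;> simpa using h
  refine h2.of_nonneg_of_le (fun i ↦ norm_nonneg _) fun i ↦ ?_
  rw [norm_mul, norm_zpow, norm_neg, norm_one, one_zpow, one_mul, norm_pow]
  exact pow_le_pow_of_le_one (norm_nonneg q) hq.le (natAbs_le_pentagonal i)

/-- Euler's pentagonal number theorem for a complex variable. -/
lemma hasSum_cF {q : ℂ} (hq : ‖q‖ < 1) :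
    HasSum (fun k : ℤ ↦ (-1 : ℂ) ^ k * q ^ pentagonal k) (cF q) := by
  have hgeo := summable_geometric_of_lt_one (norm_nonneg q) hq
  have hq0 := norm_nonneg q
  set B : ℝ := Real.exp (∑' n, ‖q‖ ^ n) with hB
  have hprod : ∀ k n, ‖∏ i ∈ Finset.range (n + 1), (1 - q ^ (k + i + 1))‖ ≤ B := by
    intro k n
    rw [norm_prod]
    calc ∏ i ∈ Finset.range (n + 1), ‖1 - q ^ (k + i + 1)‖
        ≤ ∏ i ∈ Finset.range (n + 1), Real.exp (‖q‖ ^ i) := by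
          refine Finset.prod_le_prod (fun _ _ ↦ norm_nonneg _) fun i _ ↦ ?_
          calc ‖1 - q ^ (k + i + 1)‖ ≤ 1 + ‖q‖ ^ (k + i + 1) := by
                simpa using norm_sub_le (1 : ℂ) (q ^ (k + i + 1))
            _ ≤ 1 + ‖q‖ ^ i := by
                gcongr 1 + ?_
                exact pow_le_pow_of_le_one hq0 hq.le (by omega)
            _ ≤ _ := by rw [add_comm]; exact Real.add_one_le_exp _
      _ = Real.exp (∑ i ∈ Finset.range (n + 1), ‖q‖ ^ i) := (Real.exp_sum _ _).symm
      _ ≤ B := Real.exp_le_exp.mpr (hgeo.sum_le_tsum _ fun i _ ↦ by positivity)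
  have hterm : ∀ k n, ‖q ^ ((k + 1) * n) * ∏ i ∈ Finset.range (n + 1), (1 - q ^ (k + i + 1))‖
      ≤ ‖q‖ ^ n * B := by
    intro k n
    rw [norm_mul, norm_pow]
    exact mul_le_mul (pow_le_pow_of_le_one hq0 hq.le (by nlinarith)) (hprod k n)
      (norm_nonneg _) (by positivity)
  have hsum : ∀ k, Summable (fun n ↦ q ^ ((k + 1) * n) *
      ∏ i ∈ Finset.range (n + 1), (1 - q ^ (k + i + 1))) := fun k ↦
    Summable.of_norm_bounded (hgeo.mul_right B) (hterm k)
  have hlhs : ∀ k, Multipliable (fun n ↦ 1 - q ^ (n + k + 1)) := by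
    intro k
    have := multipliable_one_add_of_summable (f := fun n ↦ -q ^ (n + k + 1)) (by
      simpa [add_assoc] using (summable_nat_add_iff (k + 1)).mpr hgeo)
    simpa [sub_eq_add_neg] using this
  have hZ := (summable_pow_pentagonal hq).hasSum
  have hZ' := hZ
  rw [← neg_injective.hasSum_iff (fun x hx ↦ by absurd hx; exact ⟨-x, by simp⟩)] at hZ'
  have hN := hZ'.nat_add_neg_add_one
  have hN : HasSum (fun k : ℕ ↦ (-1 : ℂ) ^ k * (q ^ pentagonal (-k) - q ^ pentagonal (k + 1)))
      (∑' k : ℤ, (-1 : ℂ) ^ k * q ^ pentagonal k) := by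
    convert hN using 2 with k
    simp only [Function.comp_apply, neg_neg, zpow_neg, zpow_natCast]
    rw [show ((k : ℤ) + 1) = ((k + 1 : ℕ) : ℤ) by push_cast; ring, zpow_natCast, ← inv_pow]
    norm_num
    ring
  have hmain := Pentagonal.tprod_one_sub_pow (x := q)
    (tendsto_pow_atTop_nhds_zero_of_norm_lt_one hq) hsum hlhs hN.summable (by
      have hz : Tendsto (fun k : ℕ ↦ ‖q‖ ^ k * ∑' n, ‖q‖ ^ n * B) atTop (𝓝 0) := by
        simpa using (tendsto_pow_atTop_nhds_zero_of_lt_one hq0 hq).mul_const (∑' n, ‖q‖ ^ n * B)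
      refine squeeze_zero_norm (fun k ↦ ?_) hz
      rw [norm_mul, norm_mul, norm_pow, norm_neg, norm_one, one_pow, one_mul, norm_pow]
      refine mul_le_mul ?_ ?_ (norm_nonneg _) (by positivity)
      · refine pow_le_pow_of_le_one hq0 hq.le ?_
        rw [Nat.le_div_iff_mul_le (by norm_num)]
        nlinarith
      · exact tsum_of_norm_bounded (hgeo.mul_right B).hasSum (hterm k))
  have : cF q = ∑' k : ℤ, (-1 : ℂ) ^ k * q ^ pentagonal k := by
    rw [cF, hmain, hN.tsum_eq]
  rw [this]
  exact hZ

section FifthRoots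

variable {ζ : ℂ}

lemma pow_five_eq_one (hζ : 1 + ζ + ζ ^ 2 + ζ ^ 3 + ζ ^ 4 = 0) : ζ ^ 5 = 1 := by
  linear_combination (ζ - 1) * hζ

lemma norm_eq_one_of_fifth_root (hζ : 1 + ζ + ζ ^ 2 + ζ ^ 3 + ζ ^ 4 = 0) : ‖ζ‖ = 1 := by
  have h := congrArg norm (pow_five_eq_one hζ)
  rw [norm_pow, norm_one] at h
  exact (pow_eq_one_iff_of_nonneg (norm_nonneg _) (by norm_num)).mp h

lemma pow_mod_five (hζ : 1 + ζ + ζ ^ 2 + ζ ^ 3 + ζ ^ 4 = 0) (m : ℕ) : ζ ^ m = ζ ^ (m % 5) := by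
  conv_lhs => rw [← Nat.div_add_mod m 5, pow_add, pow_mul, pow_five_eq_one hζ, one_pow, one_mul]

lemma pow_fifth_root (hζ : 1 + ζ + ζ ^ 2 + ζ ^ 3 + ζ ^ 4 = 0) {m : ℕ} (hm : ¬ 5 ∣ m) :
    1 + ζ ^ m + (ζ ^ m) ^ 2 + (ζ ^ m) ^ 3 + (ζ ^ m) ^ 4 = 0 := by
  have h5 := pow_five_eq_one hζ
  rw [pow_mod_five hζ m]
  have : m % 5 = 1 ∨ m % 5 = 2 ∨ m % 5 = 3 ∨ m % 5 = 4 := by omega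
  rcases this with h | h | h | h <;> rw [h]
  · linear_combination hζ
  · linear_combination hζ + (ζ + ζ ^ 3) * h5
  · linear_combination hζ + (ζ + ζ ^ 4 + ζ ^ 7 + ζ ^ 2) * h5
  · linear_combination hζ + (ζ ^ 3 + ζ ^ 7 + ζ ^ 2 + ζ ^ 11 + ζ ^ 6 + ζ) * h5

lemma sum_pow_mul (hζ : 1 + ζ + ζ ^ 2 + ζ ^ 3 + ζ ^ 4 = 0) (m : ℕ) :
    ∑ k ∈ Finset.range 5, ζ ^ (k * m) = if 5 ∣ m then 5 else 0 := by
  simp only [mul_comm _ m, pow_mul]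
  split_ifs with h
  · obtain ⟨t, rfl⟩ := h
    simp [pow_mul, pow_five_eq_one hζ]
  · simpa [Finset.sum_range_succ] using pow_fifth_root hζ h

lemma hasSum_proj {ι : Type*} (hζ : 1 + ζ + ζ ^ 2 + ζ ^ 3 + ζ ^ 4 = 0) (s : ι → ℂ) (e : ι → ℕ)
    (F : ℂ → ℂ) (u : ℂ) (hF : ∀ k : ℕ, HasSum (fun i ↦ s i * (ζ ^ k * u) ^ e i) (F (ζ ^ k * u)))
    (r : ℕ) :
    HasSum (fun i ↦ if 5 ∣ e i + r then 5 * (s i * u ^ e i) else 0)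
      (∑ k ∈ Finset.range 5, ζ ^ (k * r) * F (ζ ^ k * u)) := by
  have h := hasSum_sum (s := Finset.range 5) fun k _ ↦ (hF k).mul_left (ζ ^ (k * r))
  refine (congrArg (HasSum · _) (funext fun i ↦ ?_)).mpr h
  have : ∀ k, ζ ^ (k * r) * (s i * (ζ ^ k * u) ^ e i) = ζ ^ (k * (e i + r)) * (s i * u ^ e i) := by
    intro k
    rw [mul_pow, ← pow_mul, mul_add, pow_add]
    ring
  rw [Finset.sum_congr rfl fun k _ ↦ this k, ← Finset.sum_mul, sum_pow_mul hζ]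
  split_ifs <;> simp

lemma prod_one_sub_fifth_root (hζ : 1 + ζ + ζ ^ 2 + ζ ^ 3 + ζ ^ 4 = 0) (w : ℂ) :
    (1 - w) * (1 - ζ * w) * (1 - ζ ^ 2 * w) * (1 - ζ ^ 3 * w) * (1 - ζ ^ 4 * w) = 1 - w ^ 5 := by
  linear_combination (ζ ^ 6 * w ^ 4 + (1 - ζ + ζ ^ 5 - ζ ^ 6) * w ^ 5 + (-ζ ^ 3 - ζ ^ 5) * w ^ 3 + (ζ +
    ζ ^ 3) * w ^ 2 + (-1) * w) * hζ

lemma norm_dissection (hζ : 1 + ζ + ζ ^ 2 + ζ ^ 3 + ζ ^ 4 = 0) (a b c : ℂ) :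
    (a + b + c) * (a + ζ * b + ζ ^ 2 * c) * (a + ζ ^ 2 * b + ζ ^ 4 * c) *
      (a + ζ ^ 3 * b + ζ * c) * (a + ζ ^ 4 * b + ζ ^ 3 * c)
    = a ^ 5 + b ^ 5 + c ^ 5 - 5 * a * b ^ 3 * c + 5 * a ^ 2 * b * c ^ 2 := by
  linear_combination ((ζ ^ 4 + ζ ^ 5 + 2 * ζ ^ 6 + 2 * ζ ^ 7 - ζ ^ 8 + ζ ^ 9) * a * b ^ 2 * c ^ 2 +
    (ζ ^ 7 + ζ ^ 9) * b ^ 3 * c ^ 2 + (ζ ^ 7 + ζ ^ 9) * b ^ 2 * c ^ 3 + (5 - 5 * ζ + ζ ^ 4 + 4 * ζ ^ 5 -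
    2 * ζ ^ 6 + ζ ^ 7 + ζ ^ 8) * a * b ^ 3 * c + (2 * ζ ^ 5 + ζ ^ 6 + ζ ^ 8) * a * b * c ^ 3 + ζ ^ 8 *
    b ^ 4 * c + ζ ^ 8 * b * c ^ 4 + (ζ ^ 2 + ζ ^ 3 + 2 * ζ ^ 4 + 2 * ζ ^ 5 - ζ ^ 6 + ζ ^ 7) * a ^ 2 *
    b ^ 2 * c + (-5 + 5 * ζ + ζ ^ 2 + ζ ^ 3 + ζ ^ 4 + 2 * ζ ^ 6) * a ^ 2 * b * c ^ 2 + ζ ^ 6 * a * b ^ 4 +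
    ζ ^ 6 * a * c ^ 4 + (-1 + ζ - ζ ^ 5 + ζ ^ 6) * b ^ 5 + (-1 + ζ - ζ ^ 5 + ζ ^ 6) * c ^ 5 + (ζ ^ 3 +
    ζ ^ 5) * a ^ 2 * b ^ 3 + (ζ ^ 3 + ζ ^ 5) * a ^ 2 * c ^ 3 + (2 * ζ + ζ ^ 2 + ζ ^ 4) * a ^ 3 * b *
    c + (ζ + ζ ^ 3) * a ^ 3 * b ^ 2 + (ζ + ζ ^ 3) * a ^ 3 * c ^ 2 + a ^ 4 * b + a ^ 4 * c) * hζ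

lemma prod_one_sub_fifth_root_pow (hζ : 1 + ζ + ζ ^ 2 + ζ ^ 3 + ζ ^ 4 = 0) (u : ℂ) (m : ℕ) :
    ∏ k ∈ Finset.range 5, (1 - (ζ ^ k * u) ^ m) =
      if 5 ∣ m then (1 - u ^ m) ^ 5 else 1 - (u ^ 5) ^ m := by
  have : ∀ k, (ζ ^ k * u) ^ m = (ζ ^ m) ^ k * u ^ m := fun k ↦ by
    rw [mul_pow, ← pow_mul, ← pow_mul, mul_comm k]
  simp only [this]
  split_ifs with h
  · obtain ⟨t, rfl⟩ := h
    simp [pow_mul, pow_five_eq_one hζ]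
  · have h1 := prod_one_sub_fifth_root (pow_fifth_root hζ h) (u ^ m)
    simp only [Finset.prod_range_succ, Finset.prod_range_zero, pow_zero, one_mul, pow_one]
    rw [h1, ← pow_mul, ← pow_mul, mul_comm]

lemma prod_qP_fifth_root (hζ : 1 + ζ + ζ ^ 2 + ζ ^ 3 + ζ ^ 4 = 0) (u : ℂ) (N : ℕ) :
    (∏ k ∈ Finset.range 5, qP (ζ ^ k * u) (5 * N)) * qP (u ^ 25) N
      = qP (u ^ 5) (5 * N) * qP (u ^ 5) N ^ 5 := by
  induction N with
  | zero => simp [qP]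
  | succ N ih =>
    have hs : ∀ q : ℂ, qP q (5 * (N + 1)) = qP q (5 * N) * ((1 - q ^ (5 * N + 1)) *
        (1 - q ^ (5 * N + 2)) * (1 - q ^ (5 * N + 3)) * (1 - q ^ (5 * N + 4)) *
        (1 - q ^ (5 * N + 5))) := by
      intro q
      rw [show 5 * (N + 1) = 5 * N + 1 + 1 + 1 + 1 + 1 by ring]
      simp only [qP_succ]
      ring_nf
    simp only [hs, Finset.prod_mul_distrib, prod_one_sub_fifth_root_pow hζ]
    rw [if_neg (by omega), if_neg (by omega), if_neg (by omega), if_neg (by omega),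
      if_pos (by omega), qP_succ, qP_succ]
    have e1 : (u ^ 25) ^ (N + 1) = (u ^ 5) ^ (5 * N + 5) := by ring
    have e2 : u ^ (5 * N + 5) = (u ^ 5) ^ (N + 1) := by ring
    rw [e1, e2, mul_pow]
    linear_combination ((1 - (u ^ 5) ^ (5 * N + 1)) * (1 - (u ^ 5) ^ (5 * N + 2)) *
      (1 - (u ^ 5) ^ (5 * N + 3)) * (1 - (u ^ 5) ^ (5 * N + 4)) *
      (1 - (u ^ 5) ^ (5 * N + 5)) * (1 - (u ^ 5) ^ (N + 1)) ^ 5) * ih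

lemma prod_cF_fifth_root (hζ : 1 + ζ + ζ ^ 2 + ζ ^ 3 + ζ ^ 4 = 0) {u : ℂ} (hu : ‖u‖ < 1) :
    (∏ k ∈ Finset.range 5, cF (ζ ^ k * u)) * cF (u ^ 25) = cF (u ^ 5) ^ 6 := by
  have h5 : Tendsto (fun N ↦ 5 * N) atTop atTop := tendsto_id.const_mul_atTop' (by norm_num)
  have hn : ∀ n ≠ 0, ‖u ^ n‖ < 1 := fun n hn ↦ by
    rw [norm_pow]; exact pow_lt_one₀ (norm_nonneg _) hu hn
  have hk : ∀ k, ‖ζ ^ k * u‖ < 1 := fun k ↦ by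
    rwa [norm_mul, norm_pow, norm_eq_one_of_fifth_root hζ, one_pow, one_mul]
  have hl := (tendsto_finsetProd (Finset.range 5) fun k _ ↦ (tendsto_qP (hk k)).comp h5).mul
    (tendsto_qP (hn 25 (by norm_num)))
  have hr := ((tendsto_qP (hn 5 (by norm_num))).comp h5).mul
    ((tendsto_qP (hn 5 (by norm_num))).pow 5)
  simp only [Function.comp_apply, prod_qP_fifth_root hζ] at hl
  rw [tendsto_nhds_unique hl hr]
  ring

lemma proj_pentagonal_eq_zero (hζ : 1 + ζ + ζ ^ 2 + ζ ^ 3 + ζ ^ 4 = 0) {u : ℂ} (hu : ‖u‖ < 1)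
    {r : ℕ} (hr : r = 1 ∨ r = 2) :
    ∑ k ∈ Finset.range 5, ζ ^ (k * r) * cF (ζ ^ k * u) = 0 := by
  have hk : ∀ k, ‖ζ ^ k * u‖ < 1 := fun k ↦ by
    rwa [norm_mul, norm_pow, norm_eq_one_of_fifth_root hζ, one_pow, one_mul]
  have h := hasSum_proj hζ (fun k : ℤ ↦ (-1 : ℂ) ^ k) pentagonal cF u (fun k ↦ hasSum_cF (hk k)) r
  refine h.unique ?_
  convert hasSum_zero using 2 with i
  rw [if_neg]
  intro h
  have h2 := two_mul_natCast_pentagonal i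
  obtain ⟨t, ht⟩ := h
  obtain ⟨m, hm⟩ : ∃ m, i = 5 * m + i % 5 := ⟨i / 5, by omega⟩
  have hcase : i % 5 = 0 ∨ i % 5 = 1 ∨ i % 5 = 2 ∨ i % 5 = 3 ∨ i % 5 = 4 := by omega
  have ht' : (pentagonal i : ℤ) = 5 * t - r := by omega
  rw [ht'] at h2
  rcases hr with rfl | rfl <;> rcases hcase with h | h | h | h | h <;> rw [h] at hm <;>
    rw [hm] at h2 <;> push_cast at h2 <;> ring_nf at h2 <;> omega

lemma proj_jacobi_eq_zero (hζ : 1 + ζ + ζ ^ 2 + ζ ^ 3 + ζ ^ 4 = 0) {u : ℂ} (hu0 : u ≠ 0)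
    (hu : ‖u‖ < 1) {r : ℕ} (hr : r = 1 ∨ r = 3) :
    ∑ k ∈ Finset.range 5, ζ ^ (k * r) * cF (ζ ^ k * u) ^ 3 = 0 := by
  have hk : ∀ k, ‖ζ ^ k * u‖ < 1 := fun k ↦ by
    rwa [norm_mul, norm_pow, norm_eq_one_of_fifth_root hζ, one_pow, one_mul]
  have hζ0 : ζ ≠ 0 := by
    rintro rfl
    norm_num at hζ
  have h := hasSum_proj hζ (fun k : ℤ ↦ (-1 : ℂ) ^ k * k) tri (fun q ↦ cF q ^ 3) u
    (fun k ↦ hasSum_cF_pow_three (mul_ne_zero (pow_ne_zero _ hζ0) hu0) (hk k)) r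
  refine h.unique ?_
  convert hasSum_zero using 2 with i
  rw [if_neg]
  intro h
  have h2 := two_mul_tri i
  obtain ⟨t, ht⟩ := h
  obtain ⟨m, hm⟩ : ∃ m, i = 5 * m + i % 5 := ⟨i / 5, by omega⟩
  have hcase : i % 5 = 0 ∨ i % 5 = 1 ∨ i % 5 = 2 ∨ i % 5 = 3 ∨ i % 5 = 4 := by omega
  have ht' : (tri i : ℤ) = 5 * t - r := by omega
  rw [ht'] at h2
  rcases hr with rfl | rfl <;> rcases hcase with h | h | h | h | h <;> rw [h] at hm <;>
    rw [hm] at h2 <;> push_cast at h2 <;> ring_nf at h2 <;> omega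

lemma proj_pentagonal_one (hζ : 1 + ζ + ζ ^ 2 + ζ ^ 3 + ζ ^ 4 = 0) {u : ℂ} (hu : ‖u‖ < 1) :
    ∑ k ∈ Finset.range 5, ζ ^ (k * 4) * cF (ζ ^ k * u) = -5 * (u * cF (u ^ 25)) := by
  have hk : ∀ k, ‖ζ ^ k * u‖ < 1 := fun k ↦ by
    rwa [norm_mul, norm_pow, norm_eq_one_of_fifth_root hζ, one_pow, one_mul]
  have h := hasSum_proj hζ (fun k : ℤ ↦ (-1 : ℂ) ^ k) pentagonal cF u (fun k ↦ hasSum_cF (hk k)) 4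
  have hu25 : ‖u ^ 25‖ < 1 := by rw [norm_pow]; exact pow_lt_one₀ (norm_nonneg _) hu (by norm_num)
  have h25 := (hasSum_cF hu25).mul_left (-5 * u)
  have hinj : Function.Injective fun m : ℤ ↦ -5 * m + 1 := fun a b h ↦ by
    simp only at h; omega
  rw [← hinj.hasSum_iff] at h
  · rw [← mul_assoc]
    refine h.unique ?_
    refine (congrArg (HasSum · _) (funext fun m ↦ ?_)).mpr h25
    have hp : pentagonal (-5 * m + 1) = 1 + 25 * pentagonal m := by
      have h1 := two_mul_natCast_pentagonal m
      have h2 := two_mul_natCast_pentagonal (-5 * m + 1)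
      zify
      linarith
    have hs : (-1 : ℂ) ^ (-5 * m + 1) = -(-1) ^ m := by
      rw [zpow_add₀ (by norm_num), zpow_mul]
      norm_num
    simp only [Function.comp_apply]
    rw [hp, hs, if_pos (by omega)]
    ring
  · intro i hi
    rw [if_neg]
    intro h
    have h2 := two_mul_natCast_pentagonal i
    obtain ⟨t, ht⟩ := h
    obtain ⟨m, hm⟩ : ∃ m, i = 5 * m + i % 5 := ⟨i / 5, by omega⟩
    have hcase : i % 5 = 0 ∨ i % 5 = 1 ∨ i % 5 = 2 ∨ i % 5 = 3 ∨ i % 5 = 4 := by omega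
    have ht' : (pentagonal i : ℤ) = 5 * t - 4 := by omega
    rw [ht'] at h2
    rcases hcase with h | h | h | h | h
    · rw [h] at hm; rw [hm] at h2; ring_nf at h2; omega
    · exact hi ⟨-m, by simp only; omega⟩
    · rw [h] at hm; rw [hm] at h2; ring_nf at h2; omega
    · rw [h] at hm; rw [hm] at h2; ring_nf at h2; omega
    · rw [h] at hm; rw [hm] at h2; ring_nf at h2; omega

end FifthRoots

/-- The `5`-dissection of Euler's product. -/
lemma exists_dissection {u : ℂ} (hu0 : u ≠ 0) (hu : ‖u‖ < 1)
    (hne : cF u + u * cF (u ^ 25) ≠ 0) :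
    ∃ a c : ℂ, a - u * cF (u ^ 25) - c = cF u ∧ a * c = (u * cF (u ^ 25)) ^ 2 ∧
      (a ^ 5 - 11 * (u * cF (u ^ 25)) ^ 5 - c ^ 5) * cF (u ^ 25) = cF (u ^ 5) ^ 6 := by
  obtain ⟨ζ, hζ⟩ : ∃ ζ : ℂ, 1 + ζ + ζ ^ 2 + ζ ^ 3 + ζ ^ 4 = 0 := by
    have h := (Complex.isPrimitiveRoot_exp 5 (by norm_num)).geom_sum_eq_zero (by norm_num)
    exact ⟨_, by simpa [Finset.sum_range_succ] using h⟩
  have h5 := pow_five_eq_one hζ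
  have h1 := proj_pentagonal_eq_zero hζ hu (r := 1) (by simp)
  have h2 := proj_pentagonal_eq_zero hζ hu (r := 2) (by simp)
  have h4 := proj_pentagonal_one hζ hu
  have j1 := proj_jacobi_eq_zero hζ hu0 hu (r := 1) (by simp)
  have j3 := proj_jacobi_eq_zero hζ hu0 hu (r := 3) (by simp)
  have hN := prod_cF_fifth_root hζ hu
  set b := u * cF (u ^ 25) with hb
  have e6 : ζ ^ 6 = ζ := by linear_combination ζ * h5
  have e8 : ζ ^ 8 = ζ ^ 3 := by linear_combination ζ ^ 3 * h5
  have e9 : ζ ^ 9 = ζ ^ 4 := by linear_combination ζ ^ 4 * h5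
  have e12 : ζ ^ 12 = ζ ^ 2 := by linear_combination (ζ ^ 7 + ζ ^ 2) * h5
  have e16 : ζ ^ 16 = ζ := by linear_combination (ζ ^ 11 + ζ ^ 6 + ζ) * h5
  simp only [Finset.sum_range_succ, Finset.sum_range_zero, Finset.prod_range_succ,
    Finset.prod_range_zero, zero_mul, zero_add, one_mul, pow_zero, pow_one, mul_one,
    Nat.reduceMul, e6, e8, e9, e12, e16] at h1 h2 h4 j1 j3 hN
  obtain ⟨F1, hF1⟩ : ∃ x, x = cF (ζ * u) := ⟨_, rfl⟩
  obtain ⟨F2, hF2⟩ : ∃ x, x = cF (ζ ^ 2 * u) := ⟨_, rfl⟩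
  obtain ⟨F3, hF3⟩ : ∃ x, x = cF (ζ ^ 3 * u) := ⟨_, rfl⟩
  obtain ⟨F4, hF4⟩ : ∃ x, x = cF (ζ ^ 4 * u) := ⟨_, rfl⟩
  obtain ⟨F0, hF0⟩ : ∃ x, x = cF u := ⟨_, rfl⟩
  rw [← hF0] at hne ⊢
  rw [← hF1, ← hF2, ← hF3, ← hF4, ← hF0] at h1 h2 h4 j1 j3 hN
  obtain ⟨a, ha⟩ : ∃ x, x = (F0 + F1 + F2 + F3 + F4) / 5 := ⟨_, rfl⟩
  obtain ⟨c, hc⟩ : ∃ x, x = (F0 + ζ ^ 3 * F1 + ζ * F2 + ζ ^ 4 * F3 + ζ ^ 2 * F4) / 5 := ⟨_, rfl⟩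
  obtain ⟨b', hb'⟩ : ∃ x, x = -b := ⟨_, rfl⟩
  have hb4 : 5 * b' = F0 + ζ ^ 4 * F1 + ζ ^ 3 * F2 + ζ ^ 2 * F3 + ζ * F4 := by
    rw [hb']; linear_combination -h4
  have ha5 : 5 * a = F0 + F1 + F2 + F3 + F4 := by rw [ha]; ring
  have hc5 : 5 * c = F0 + ζ ^ 3 * F1 + ζ * F2 + ζ ^ 4 * F3 + ζ ^ 2 * F4 := by rw [hc]; ring
  have g0 : F0 = a + b' + c := by
    linear_combination (-ha5 - hb4 - hc5 + h2 + h1 +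
      ((-1) * F1 + (-1) * F2 + (-1) * F3 + (-1) * F4) * hζ) / 5
  have g1 : F1 = a + ζ * b' + ζ ^ 2 * c := by
    linear_combination (-ha5 - ζ * hb4 - ζ ^ 2 * hc5 + ζ ^ 3 * h2 + ζ ^ 4 * h1 +
      ((-1) * F0 + (4 - 4 * ζ) * F1 + (-1 + ζ - ζ ^ 3) * F2 + (-1 + ζ - ζ ^ 3) * F3 + (-1 + ζ - ζ ^ 2 +
        ζ ^ 3 - ζ ^ 4) * F4) * hζ) / 5
  have g2 : F2 = a + ζ ^ 2 * b' + ζ ^ 4 * c := by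
    linear_combination (-ha5 - ζ ^ 2 * hb4 - ζ ^ 4 * hc5 + ζ * h2 + ζ ^ 3 * h1 +
      ((-1) * F0 + (-1 + ζ - ζ ^ 3) * F1 + (4 - 4 * ζ) * F2 + (-1 + ζ - ζ ^ 2 + ζ ^ 3 - ζ ^ 4) * F3 +
        (-1 + ζ - ζ ^ 3) * F4) * hζ) / 5
  have g3 : F3 = a + ζ ^ 3 * b' + ζ * c := by
    linear_combination (-ha5 - ζ ^ 3 * hb4 - ζ * hc5 + ζ ^ 4 * h2 + ζ ^ 2 * h1 +
      ((-1) * F0 + (-1 + ζ - ζ ^ 3) * F1 + (-1 + ζ - ζ ^ 2 + ζ ^ 3 - ζ ^ 4) * F2 + (4 - 4 * ζ) * F3 +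
        (-1 + ζ - ζ ^ 3) * F4) * hζ) / 5
  have g4 : F4 = a + ζ ^ 4 * b' + ζ ^ 3 * c := by
    linear_combination (-ha5 - ζ ^ 4 * hb4 - ζ ^ 3 * hc5 + ζ ^ 2 * h2 + ζ * h1 +
      ((-1) * F0 + (-1 + ζ - ζ ^ 2 + ζ ^ 3 - ζ ^ 4) * F1 + (-1 + ζ - ζ ^ 3) * F2 + (-1 + ζ - ζ ^ 3) *
        F3 + (4 - 4 * ζ) * F4) * hζ) / 5
  rw [g0, g1, g2, g3, g4] at j1 j3
  have k3 : a * (b' ^ 2 + a * c) = 0 := by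
    linear_combination (j3 - ((1 - ζ + ζ ^ 5 - ζ ^ 8 + ζ ^ 10) * b' ^ 3 + (1 - ζ + ζ ^ 5 - ζ ^ 6 + ζ ^ 7 -
      ζ ^ 8 + ζ ^ 9) * c ^ 3 + (3 - 3 * ζ + 3 * ζ ^ 5 - 3 * ζ ^ 6 + 3 * ζ ^ 7 - 3 * ζ ^ 8 + 3 * ζ ^ 9) *
      b' ^ 2 * c + (3 - 3 * ζ + 3 * ζ ^ 5 - 3 * ζ ^ 6 + 3 * ζ ^ 8) * b' * c ^ 2 + (-12 + 12 * ζ - 6 *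
      ζ ^ 5 + 6 * ζ ^ 6) * a * b' ^ 2 + (3 - 3 * ζ + 3 * ζ ^ 5) * a * c ^ 2 + (6 - 6 * ζ + 6 * ζ ^ 5) *
      a * b' * c + (3 - 3 * ζ + 3 * ζ ^ 3) * a ^ 2 * b' + (-12 + 12 * ζ) * a ^ 2 * c + a ^ 3) * hζ) / 15
  have k1 : c * (b' ^ 2 + a * c) = 0 := by
    linear_combination (j1 - ((1 - ζ + ζ ^ 4 - ζ ^ 6 + ζ ^ 8 - ζ ^ 11 + ζ ^ 12) * b' ^ 3 + (-12 + 12 *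
      ζ - 9 * ζ ^ 5 + 9 * ζ ^ 6 - 3 * ζ ^ 10 + 3 * ζ ^ 11) * b' ^ 2 * c + (1 - ζ + ζ ^ 5 - ζ ^ 8 + ζ ^ 10) *
      c ^ 3 + (3 - 3 * ζ + 3 * ζ ^ 5 - 3 * ζ ^ 7 + 3 * ζ ^ 8 - 3 * ζ ^ 9 + 3 * ζ ^ 10) * b' * c ^ 2 +
      (3 - 3 * ζ + 3 * ζ ^ 3 - 3 * ζ ^ 4 + 3 * ζ ^ 5 - 3 * ζ ^ 7 + 3 * ζ ^ 8) * a * b' ^ 2 + (6 - 6 *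
      ζ + 6 * ζ ^ 4 - 6 * ζ ^ 6 + 6 * ζ ^ 7) * a * b' * c + (-12 + 12 * ζ - 6 * ζ ^ 5 + 6 * ζ ^ 6) *
      a * c ^ 2 + (3 - 3 * ζ + 3 * ζ ^ 2 - 3 * ζ ^ 3 + 3 * ζ ^ 4) * a ^ 2 * b' + (3 - 3 * ζ + 3 * ζ ^ 3) *
      a ^ 2 * c + a ^ 3) * hζ) / 15
  have hac : b' ^ 2 + a * c = 0 := by
    by_contra h
    have ha0 : a = 0 := by simpa [h] using k3
    have hc0 : c = 0 := by simpa [h] using k1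
    exact hne (by rw [g0, ha0, hc0, hb']; ring)
  have hNN := norm_dissection hζ a b' c
  rw [g0, g1, g2, g3, g4, hNN] at hN
  refine ⟨a, -c, by rw [g0, hb']; ring, ?_, ?_⟩
  · rw [hb'] at hac
    linear_combination -hac
  · rw [← hN]
    have hbb : b = -b' := by rw [hb']; ring
    rw [hbb]
    linear_combination (5 * b' ^ 3 + 5 * b' * (b' ^ 2 - a * c)) * cF (u ^ 25) * hac

lemma tendsto_prod_eulerF {q : ℝ} (hq : |q| < 1) :
    Tendsto (fun n ↦ ∏ k ∈ Finset.range n, (1 - q ^ (k + 1))) atTop (𝓝 (eulerF q)) := by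
  have h : Multipliable fun n : ℕ ↦ 1 + -q ^ (n + 1) := multipliable_one_add_of_summable (by
    simpa using (summable_nat_add_iff 1).mpr (summable_geometric_of_lt_one (abs_nonneg q) hq))
  simp only [← sub_eq_add_neg] at h
  exact h.hasProd.tendsto_prod_nat

lemma ofReal_eulerF {q : ℝ} (hq : |q| < 1) : (eulerF q : ℂ) = cF q := by
  have h1 := (Complex.continuous_ofReal.tendsto _).comp (tendsto_prod_eulerF hq)
  have h2 := tendsto_qP (q := (q : ℂ)) (by simpa using hq)
  refine tendsto_nhds_unique h1 (h2.congr fun n ↦ ?_)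
  simp [qP]

lemma eulerF_pos {q : ℝ} (h0 : 0 ≤ q) (h1 : q < 1) : 0 < eulerF q := by
  have hq : |q| < 1 := by rwa [abs_of_nonneg h0]
  refine lt_of_le_of_ne (ge_of_tendsto' (tendsto_prod_eulerF hq) fun n ↦
    Finset.prod_nonneg fun k _ ↦ sub_nonneg.mpr (pow_le_one₀ h0 h1.le)) fun h ↦ ?_
  exact cF_ne_zero (q := (q : ℂ)) (by simpa using hq) (by rw [← ofReal_eulerF hq, ← h]; simp)

lemma eulerF_zero : eulerF 0 = 1 := by simp [eulerF]

lemma hasDerivAt_eulerF {q : ℝ} (hq : |q| < 1) :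
    HasDerivAt eulerF (deriv cF (q : ℂ)).re q := by
  have hd : DifferentiableAt ℂ cF q :=
    ModularForm.differentiableOn_tprod_one_sub_pow.differentiableAt
      (Metric.isOpen_ball.mem_nhds (by simpa using hq))
  refine hd.hasDerivAt.real_of_complex.congr_of_eventuallyEq ?_
  have : ∀ᶠ x in 𝓝 q, |x| < 1 := (isOpen_lt continuous_abs continuous_const).mem_nhds hq
  filter_upwards [this] with x hx
  rw [← ofReal_eulerF hx, Complex.ofReal_re]

lemma continuousAt_deriv_cF {q : ℝ} (hq : |q| < 1) :
    ContinuousAt (fun x : ℝ ↦ (deriv cF (x : ℂ)).re) q := by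
  have h : ContinuousAt (deriv cF) (q : ℂ) :=
    ((ModularForm.differentiableOn_tprod_one_sub_pow.deriv
      Metric.isOpen_ball).differentiableAt
      (Metric.isOpen_ball.mem_nhds (by simpa using hq))).continuousAt
  exact Complex.continuous_re.continuousAt.comp (h.comp Complex.continuous_ofReal.continuousAt)

lemma yF_pow_five {u : ℝ} (hu : 0 < u) :
    yF (u ^ 5) = eulerF u / (u * eulerF (u ^ 25)) := by
  have : (u ^ 5) ^ ((1 : ℝ) / 5) = u := by
    rw [← Real.rpow_natCast, ← Real.rpow_mul hu.le]; norm_num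
  rw [yF, this, ← pow_mul]

lemma exists_pow_five {q : ℝ} (h0 : 0 < q) (h1 : q < 1) :
    ∃ u : ℝ, 0 < u ∧ u < 1 ∧ u ^ 5 = q := by
  refine ⟨q ^ ((1 : ℝ) / 5), by positivity, Real.rpow_lt_one h0.le h1 (by norm_num), ?_⟩
  rw [← Real.rpow_natCast, ← Real.rpow_mul h0.le]; norm_num

lemma yF_pos {q : ℝ} (h0 : 0 < q) (h1 : q < 1) : 0 < yF q := by
  obtain ⟨u, hu0, hu1, rfl⟩ := exists_pow_five h0 h1
  rw [yF_pow_five hu0]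
  exact div_pos (eulerF_pos hu0.le hu1)
    (mul_pos hu0 (eulerF_pos (by positivity) (pow_lt_one₀ hu0.le hu1 (by norm_num))))

lemma RRcf_pos (q : ℝ) : 0 < RRcf q := by
  have : yF q + 1 < √(yF q ^ 2 + 2 * yF q + 5) :=
    Real.lt_sqrt_of_sq_lt (by nlinarith)
  rw [RRcf]
  linarith

lemma one_sub_RRcf_sub_sq (q : ℝ) : 1 - RRcf q - RRcf q ^ 2 = yF q * RRcf q := by
  have h := Real.sq_sqrt (show 0 ≤ yF q ^ 2 + 2 * yF q + 5 by nlinarith [sq_nonneg (yF q + 1)])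
  rw [RRcf]
  linear_combination -h / 4

lemma one_sub_RRcf_sub_sq_pos {q : ℝ} (h0 : 0 < q) (h1 : q < 1) :
    0 < 1 - RRcf q - RRcf q ^ 2 := by
  rw [one_sub_RRcf_sub_sq]
  exact mul_pos (yF_pos h0 h1) (RRcf_pos q)

/-- The relation `1 / R⁵ - 11 - R⁵ = f(-q)⁶ / (q f(-q⁵)⁶)`. -/
lemma RRcf_pow_five_relation {q : ℝ} (h0 : 0 < q) (h1 : q < 1) :
    (1 - 11 * RRcf q ^ 5 - (RRcf q ^ 5) ^ 2) * (q * eulerF (q ^ 5) ^ 6) =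
      RRcf q ^ 5 * eulerF q ^ 6 := by
  obtain ⟨u, hu0, hu1, rfl⟩ := exists_pow_five h0 h1
  have hlt : ∀ n ≠ 0, |u ^ n| < 1 := fun n hn ↦ by
    rw [abs_of_pos (pow_pos hu0 n)]; exact pow_lt_one₀ hu0.le hu1 hn
  have hu : |u| < 1 := by simpa using hlt 1 one_ne_zero
  have e1 := ofReal_eulerF hu
  have e5 := ofReal_eulerF (hlt 5 (by norm_num))
  have e25 := ofReal_eulerF (hlt 25 (by norm_num))
  have p1 := eulerF_pos hu0.le hu1
  have p25 := eulerF_pos (pow_pos hu0 25).le (pow_lt_one₀ hu0.le hu1 (by norm_num))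
  push_cast at e5 e25
  have hy := one_sub_RRcf_sub_sq (u ^ 5)
  have hR := RRcf_pos (u ^ 5)
  have hyu := yF_pow_five hu0
  rw [show (u ^ 5) ^ 5 = u ^ 25 by ring]
  generalize RRcf (u ^ 5) = R at *
  generalize yF (u ^ 5) = y at *
  obtain ⟨a, c, h1, h2, h3⟩ := exists_dissection (u := u)
    (by exact_mod_cast hu0.ne') (by simpa using hu) (by
      rw [← e1, ← e25]
      exact_mod_cast (by positivity : 0 < eulerF u + u * eulerF (u ^ 25)).ne')
  rw [← e1, ← e25] at h1
  rw [← e25] at h2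
  rw [← e25, ← e5] at h3
  generalize eulerF (u ^ 5) = f5 at *
  generalize eulerF (u ^ 25) = f25 at *
  have hyu' : eulerF u = y * (u * f25) := by rw [hyu]; field_simp
  rw [hyu'] at h1
  obtain ⟨b, hb⟩ : ∃ b : ℂ, b = u * f25 := ⟨_, rfl⟩
  have hb0 : b ≠ 0 := by rw [hb]; exact_mod_cast (by positivity : 0 < u * f25).ne'
  have hR0 : (R : ℂ) ≠ 0 := by exact_mod_cast hR.ne'
  have hyC : 1 - (R : ℂ) - R ^ 2 = y * R := by exact_mod_cast hy
  push_cast at h1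
  rw [← hb] at h1 h2 h3
  have hfac : (c - b * R) * (c * R + b) = 0 := by
    linear_combination b * c * hyC - R * c * h1 + R * h2
  have key : R ^ 5 * (a ^ 5 - 11 * b ^ 5 - c ^ 5) = b ^ 5 * (1 - 11 * R ^ 5 - (R ^ 5) ^ 2) := by
    rcases mul_eq_zero.mp hfac with h | h
    · have hc : c = b * R := by linear_combination h
      have ha : a * R = b := by
        refine mul_left_cancel₀ hb0 ?_
        rw [hc] at h2
        linear_combination h2
      rw [hc, ← ha]
      ring
    · have hb' : b = -(c * R) := by linear_combination h
      have hc0 : c ≠ 0 := by rintro rfl; simp [hb'] at hb0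
      have ha : a = c * R ^ 2 := by
        refine mul_right_cancel₀ hc0 ?_
        rw [h2, hb']
        ring
      rw [hb', ha]
      ring
  have : ((1 - 11 * R ^ 5 - (R ^ 5) ^ 2 : ℝ) : ℂ) * (u ^ 5 * f25 ^ 6) = R ^ 5 * f5 ^ 6 := by
    push_cast
    rw [← h3]
    linear_combination (-f25) * key + (-(1 - 11 * R ^ 5 - (R ^ 5) ^ 2) * f25) * congrArg (· ^ 5) hb
  exact_mod_cast this

lemma one_sub_eleven_pos {q : ℝ} (h0 : 0 < q) (h1 : q < 1) :
    0 < 1 - 11 * RRcf q ^ 5 - (RRcf q ^ 5) ^ 2 := by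
  have h := RRcf_pow_five_relation h0 h1
  have p1 := eulerF_pos h0.le h1
  have p5 := eulerF_pos (pow_pos h0 5).le (pow_lt_one₀ h0.le h1 (by norm_num))
  have hR := RRcf_pos q
  have : 0 < (1 - 11 * RRcf q ^ 5 - (RRcf q ^ 5) ^ 2) * (q * eulerF (q ^ 5) ^ 6) := by
    rw [h]; positivity
  exact pos_of_mul_pos_left this (by positivity)

/-- The numerator of the degree five modular equation of the Rogers–Ramanujan fraction. -/
def rrNum (R : ℝ) : ℝ := 1 - 2 * R + 4 * R ^ 2 - 3 * R ^ 3 + R ^ 4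

/-- The denominator of the degree five modular equation of the Rogers–Ramanujan fraction. -/
def rrDen (R : ℝ) : ℝ := 1 + 3 * R + 4 * R ^ 2 + 2 * R ^ 3 + R ^ 4

lemma rrNum_pos (R : ℝ) : 0 < rrNum R := by
  rw [rrNum]
  nlinarith [sq_nonneg (R ^ 2 - 3 / 2 * R), sq_nonneg (R - 4 / 7), sq_nonneg R]

lemma rrDen_pos {R : ℝ} (hR : 0 < R) : 0 < rrDen R := by
  rw [rrDen]
  positivity

lemma one_sub_mul_rrNum_mul_rrDen (R : ℝ) :
    (1 - R - R ^ 2) * (rrNum R * rrDen R) = 1 - 11 * R ^ 5 - (R ^ 5) ^ 2 := by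
  simp only [rrNum, rrDen]
  ring

/-- The degree five modular equation of the Rogers–Ramanujan fraction. -/
lemma RRcf_modular_equation {u : ℝ} (h0 : 0 < u) (h1 : u < 1) :
    RRcf u ^ 5 = RRcf (u ^ 5) * rrNum (RRcf (u ^ 5)) / rrDen (RRcf (u ^ 5)) := by
  have h05 := pow_pos h0 5
  have h15 : u ^ 5 < 1 := pow_lt_one₀ h0.le h1 (by norm_num)
  have hA := RRcf_pow_five_relation h0 h1
  have hB := RRcf_pow_five_relation h05 h15
  have hy := one_sub_RRcf_sub_sq (u ^ 5)
  rw [yF_pow_five h0] at hy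
  rw [show (u ^ 5) ^ 5 = u ^ 25 by ring, ← one_sub_mul_rrNum_mul_rrDen] at hB
  have hR := RRcf_pos (u ^ 5)
  have hs := one_sub_RRcf_sub_sq_pos h05 h15
  have p1 := eulerF_pos h0.le h1
  have p5 := eulerF_pos h05.le h15
  have p25 := eulerF_pos (pow_pos h0 25).le (pow_lt_one₀ h0.le h1 (by norm_num))
  have hN := rrNum_pos (RRcf (u ^ 5))
  have hD := rrDen_pos hR
  have hX : 0 < RRcf u ^ 5 := pow_pos (RRcf_pos u) 5
  have hid : rrDen (RRcf (u ^ 5)) ^ 2 - 11 * (RRcf (u ^ 5) * rrNum (RRcf (u ^ 5))) *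
      rrDen (RRcf (u ^ 5)) - (RRcf (u ^ 5) * rrNum (RRcf (u ^ 5))) ^ 2 =
      (1 - RRcf (u ^ 5) - RRcf (u ^ 5) ^ 2) ^ 5 := by
    simp only [rrNum, rrDen]
    ring
  generalize RRcf u ^ 5 = X at *
  generalize RRcf (u ^ 5) = R at *
  generalize rrNum R = N at *
  generalize rrDen R = D at *
  generalize eulerF u = f1 at *
  generalize eulerF (u ^ 5) = f5 at *
  generalize eulerF (u ^ 25) = f25 at *
  obtain ⟨s, hs'⟩ : ∃ s, s = 1 - R - R ^ 2 := ⟨_, rfl⟩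
  rw [← hs'] at hy hB hs hid
  have hf1 : f1 * R = s * (u * f25) := by rw [hy]; field_simp
  have hmain : (1 - 11 * X - X ^ 2) * (R * N * D) = X * s ^ 5 := by
    have hne : u * f5 ^ 6 * s * R ^ 5 ≠ 0 := by positivity
    refine mul_left_cancel₀ hne ?_
    linear_combination (R ^ 6 * s * N * D) * hA + X * s * N * D *
      (congrArg (· ^ 6) hf1) + X * s ^ 6 * u * hB
  have hfac : (X * D - R * N) * (X * R * N + D) = 0 := by
    linear_combination X * hid - hmain
  rcases mul_eq_zero.mp hfac with h | h
  · rw [eq_div_iff hD.ne']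
    linear_combination h
  · have : 0 < X * R * N + D := by positivity
    exact absurd h this.ne'

lemma differentiableAt_RRcf {q : ℝ} (h0 : 0 < q) (h1 : q < 1) : DifferentiableAt ℝ RRcf q := by
  have hp : DifferentiableAt ℝ (fun x : ℝ ↦ x ^ ((1 : ℝ) / 5)) q :=
    (Real.differentiableAt_rpow_const_of_ne _ h0.ne')
  have hq5 := pow_lt_one₀ h0.le h1 (n := 5) (by norm_num)
  have hq5' := Real.rpow_lt_one h0.le h1 (z := 1 / 5) (by norm_num)
  have e1 : DifferentiableAt ℝ (fun x : ℝ ↦ eulerF (x ^ ((1 : ℝ) / 5))) q :=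
    (hasDerivAt_eulerF (by rwa [abs_of_pos (by positivity)])).differentiableAt.comp q hp
  have e5 : DifferentiableAt ℝ (fun x : ℝ ↦ eulerF (x ^ 5)) q :=
    (hasDerivAt_eulerF (by rwa [abs_of_pos (by positivity)])).differentiableAt.comp q
      (differentiableAt_pow 5)
  have hy : DifferentiableAt ℝ yF q :=
    e1.div (hp.mul e5) (mul_pos (by positivity) (eulerF_pos (pow_pos h0 5).le hq5)).ne'
  have hs : yF q ^ 2 + 2 * yF q + 5 ≠ 0 := by nlinarith [sq_nonneg (yF q + 1)]
  exact (((((hy.pow 2).add (hy.const_mul 2)).add_const 5).sqrt hs).sub hy |>.sub_const 1).div_const 2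

/-- The logarithmic derivative `q d/dq log R(q)⁵`. -/
noncomputable def rrLog (q : ℝ) : ℝ := 5 * q * deriv RRcf q / RRcf q

/-- The quotient `f(-q)⁵ / f(-q⁵)`. -/
noncomputable def eulerQuot (q : ℝ) : ℝ := eulerF q ^ 5 / eulerF (q ^ 5)

lemma rrLog_step {u : ℝ} (h0 : 0 < u) (h1 : u < 1) :
    rrLog u * (rrNum (RRcf (u ^ 5)) * rrDen (RRcf (u ^ 5))) =
      (1 - RRcf (u ^ 5) - RRcf (u ^ 5) ^ 2) ^ 4 * rrLog (u ^ 5) := by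
  have h05 := pow_pos h0 5
  have h15 : u ^ 5 < 1 := pow_lt_one₀ h0.le h1 (by norm_num)
  have hR := RRcf_pos (u ^ 5)
  have hN := rrNum_pos (RRcf (u ^ 5))
  have hD := rrDen_pos hR
  have d1 := (differentiableAt_RRcf h0 h1).hasDerivAt.pow 5
  have d5 : HasDerivAt (fun v : ℝ ↦ RRcf (v ^ 5)) (deriv RRcf (u ^ 5) * (5 * u ^ 4)) u := by
    refine (HasDerivAt.comp (h := fun v : ℝ ↦ v ^ 5) u
      (differentiableAt_RRcf h05 h15).hasDerivAt (hasDerivAt_pow 5 u)).congr_deriv ?_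
    norm_num
  have dN : HasDerivAt (fun v : ℝ ↦ rrNum (RRcf (v ^ 5)))
      ((-2 + 8 * RRcf (u ^ 5) - 9 * RRcf (u ^ 5) ^ 2 + 4 * RRcf (u ^ 5) ^ 3) *
        (deriv RRcf (u ^ 5) * (5 * u ^ 4))) u := by
    refine ((((d5.const_mul 2).const_sub 1).add ((d5.pow 2).const_mul 4)).sub
      ((d5.pow 3).const_mul 3)).add (d5.pow 4) |>.congr_deriv ?_
    push_cast
    ring
  have dD : HasDerivAt (fun v : ℝ ↦ rrDen (RRcf (v ^ 5)))
      ((3 + 8 * RRcf (u ^ 5) + 6 * RRcf (u ^ 5) ^ 2 + 4 * RRcf (u ^ 5) ^ 3) *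
        (deriv RRcf (u ^ 5) * (5 * u ^ 4))) u := by
    refine ((((d5.const_mul 3).const_add 1).add ((d5.pow 2).const_mul 4)).add
      ((d5.pow 3).const_mul 2)).add (d5.pow 4) |>.congr_deriv ?_
    push_cast
    ring
  have dF := (d5.mul dN).div dD hD.ne'
  have heq : (fun v ↦ RRcf v ^ 5) =ᶠ[𝓝 u]
      fun v ↦ RRcf (v ^ 5) * rrNum (RRcf (v ^ 5)) / rrDen (RRcf (v ^ 5)) := by
    filter_upwards [isOpen_Ioo.mem_nhds (⟨h0, h1⟩ : u ∈ Set.Ioo (0 : ℝ) 1)] with v hv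
    exact RRcf_modular_equation hv.1 hv.2
  have huniq := (d1.congr_of_eventuallyEq heq.symm).unique dF
  have hmod := RRcf_modular_equation h0 h1
  have hr := RRcf_pos u
  simp only [Pi.mul_apply, Nat.cast_ofNat, Nat.add_one_sub_one] at huniq
  rw [eq_div_iff (by positivity)] at huniq
  rw [eq_div_iff hD.ne'] at hmod
  have hbr : rrNum (RRcf (u ^ 5)) * rrDen (RRcf (u ^ 5)) + RRcf (u ^ 5) *
      ((-2 + 8 * RRcf (u ^ 5) - 9 * RRcf (u ^ 5) ^ 2 + 4 * RRcf (u ^ 5) ^ 3) *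
        rrDen (RRcf (u ^ 5)) - rrNum (RRcf (u ^ 5)) *
        (3 + 8 * RRcf (u ^ 5) + 6 * RRcf (u ^ 5) ^ 2 + 4 * RRcf (u ^ 5) ^ 3)) =
      (1 - RRcf (u ^ 5) - RRcf (u ^ 5) ^ 2) ^ 4 := by
    simp only [rrNum, rrDen]
    ring
  simp only [rrLog]
  rw [← hbr]
  generalize RRcf (u ^ 5) = R at *
  generalize rrNum R = N at *
  generalize rrDen R = D at *
  generalize RRcf u = r at *
  generalize deriv RRcf u = r' at *
  generalize deriv RRcf (u ^ 5) = R' at *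
  rw [div_mul_eq_mul_div, ← mul_div_assoc, div_eq_div_iff hr.ne' hR.ne']
  refine mul_left_cancel₀ (by positivity : r ^ 4 * D ≠ 0) ?_
  linear_combination u * N * R * huniq - (N * D + R * ((-2 + 8 * R - 9 * R ^ 2 + 4 * R ^ 3) * D -
    N * (3 + 8 * R + 6 * R ^ 2 + 4 * R ^ 3))) * (5 * u ^ 5 * R') * hmod

lemma eulerQuot_step {u : ℝ} (h0 : 0 < u) (h1 : u < 1) :
    eulerQuot u * (rrNum (RRcf (u ^ 5)) * rrDen (RRcf (u ^ 5))) =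
      (1 - RRcf (u ^ 5) - RRcf (u ^ 5) ^ 2) ^ 4 * eulerQuot (u ^ 5) := by
  have h05 := pow_pos h0 5
  have h15 : u ^ 5 < 1 := pow_lt_one₀ h0.le h1 (by norm_num)
  have hB := RRcf_pow_five_relation h05 h15
  have hy := one_sub_RRcf_sub_sq (u ^ 5)
  rw [yF_pow_five h0] at hy
  rw [show (u ^ 5) ^ 5 = u ^ 25 by ring, ← one_sub_mul_rrNum_mul_rrDen] at hB
  have hR := RRcf_pos (u ^ 5)
  have hs := one_sub_RRcf_sub_sq_pos h05 h15
  have p1 := eulerF_pos h0.le h1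
  have p5 := eulerF_pos h05.le h15
  have p25 := eulerF_pos (pow_pos h0 25).le (pow_lt_one₀ h0.le h1 (by norm_num))
  simp only [eulerQuot]
  rw [show (u ^ 5) ^ 5 = u ^ 25 by ring]
  generalize RRcf (u ^ 5) = R at *
  generalize rrNum R = N at *
  generalize rrDen R = D at *
  generalize eulerF u = f1 at *
  generalize eulerF (u ^ 5) = f5 at *
  generalize eulerF (u ^ 25) = f25 at *
  obtain ⟨s, hs'⟩ : ∃ s, s = 1 - R - R ^ 2 := ⟨_, rfl⟩
  rw [← hs'] at hy hB hs ⊢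
  have hf1 : f1 * R = s * (u * f25) := by rw [hy]; field_simp
  rw [div_mul_eq_mul_div, ← mul_div_assoc, div_eq_div_iff p5.ne' p25.ne']
  refine mul_left_cancel₀ (by positivity : R ^ 5 * s ≠ 0) ?_
  linear_combination (s * N * D * f25) * congrArg (· ^ 5) hf1 + s ^ 5 * hB

lemma hasDerivAt_eulerF_pow_five {q : ℝ} (h0 : 0 < q) (h1 : q < 1) :
    HasDerivAt (fun v : ℝ ↦ eulerF (v ^ 5)) ((deriv cF ((q ^ 5 : ℝ) : ℂ)).re * (5 * q ^ 4)) q := by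
  have hq5 := pow_lt_one₀ h0.le h1 (n := 5) (by norm_num)
  refine (HasDerivAt.comp (h := fun v : ℝ ↦ v ^ 5) q
    (hasDerivAt_eulerF (by rwa [abs_of_pos (by positivity)])) (hasDerivAt_pow 5 q)).congr_deriv ?_
  norm_num

lemma rrLog_eq {q : ℝ} (h0 : 0 < q) (h1 : q < 1) :
    rrLog q = (eulerF q ^ 6 / eulerF (q ^ 5) ^ 6 * (eulerF (q ^ 5) ^ 6 + 30 * q ^ 5 *
      eulerF (q ^ 5) ^ 5 * (deriv cF ((q ^ 5 : ℝ) : ℂ)).re) -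
      6 * q * eulerF q ^ 5 * (deriv cF (q : ℂ)).re) /
      (eulerF q ^ 6 + (11 + 2 * RRcf q ^ 5) * q * eulerF (q ^ 5) ^ 6) := by
  have p1 := eulerF_pos h0.le h1
  have p5 := eulerF_pos (pow_pos h0 5).le (pow_lt_one₀ h0.le h1 (by norm_num))
  have hR := RRcf_pos q
  have hA := RRcf_pow_five_relation h0 h1
  have dR := (differentiableAt_RRcf h0 h1).hasDerivAt.fun_pow 5
  have d1 := (hasDerivAt_eulerF (q := q) (by rwa [abs_of_pos h0])).fun_pow 6
  have d5 := (hasDerivAt_eulerF_pow_five h0 h1).fun_pow 6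
  have hL := (((dR.const_mul 11).const_sub 1).fun_sub (dR.fun_pow 2)).fun_mul
    ((hasDerivAt_id' q).fun_mul d5)
  have hr := dR.fun_mul d1
  have heq : (fun v : ℝ ↦ (1 - 11 * RRcf v ^ 5 - (RRcf v ^ 5) ^ 2) * (v * eulerF (v ^ 5) ^ 6))
      =ᶠ[𝓝 q] fun v ↦ RRcf v ^ 5 * eulerF v ^ 6 := by
    filter_upwards [isOpen_Ioo.mem_nhds (⟨h0, h1⟩ : q ∈ Set.Ioo (0 : ℝ) 1)] with v hv
    exact RRcf_pow_five_relation hv.1 hv.2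
  have huniq := (hr.congr_of_eventuallyEq heq).unique hL
  push_cast at huniq
  rw [rrLog, div_eq_div_iff hR.ne' (by positivity)]
  generalize RRcf q = R at *
  generalize eulerF q = f at *
  generalize eulerF (q ^ 5) = f5 at *
  generalize deriv RRcf q = R' at *
  obtain ⟨t, ht⟩ : ∃ t, t = f ^ 6 / f5 ^ 6 := ⟨_, rfl⟩
  rw [← ht]
  rw [eq_div_iff (by positivity)] at ht
  have hS : (1 - 11 * R ^ 5 - (R ^ 5) ^ 2) * q = R ^ 5 * t := by
    refine mul_right_cancel₀ (by positivity : f5 ^ 6 ≠ 0) ?_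
    linear_combination hA - R ^ 5 * ht
  refine mul_left_cancel₀ (by positivity : R ^ 4 ≠ 0) ?_
  push_cast
  linear_combination q * huniq + (f5 ^ 6 + 30 * q ^ 5 * f5 ^ 5 * (deriv cF ((q : ℂ) ^ 5)).re) * hS

lemma tendsto_eulerF_zero : Tendsto eulerF (𝓝[>] 0) (𝓝 1) := by
  have h := (hasDerivAt_eulerF (q := 0) (by simp)).continuousAt.tendsto
  rw [eulerF_zero] at h
  exact h.mono_left nhdsWithin_le_nhds

lemma tendsto_pow_five_zero : Tendsto (fun q : ℝ ↦ q ^ 5) (𝓝[>] 0) (𝓝[>] 0) := by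
  refine tendsto_nhdsWithin_iff.mpr ⟨?_, ?_⟩
  · have h := (continuous_pow 5).tendsto (0 : ℝ)
    rw [zero_pow (by norm_num)] at h
    exact h.mono_left nhdsWithin_le_nhds
  · filter_upwards [self_mem_nhdsWithin] with q hq
    exact pow_pos (Set.mem_Ioi.mp hq) 5

lemma eventually_mem_Ioo : ∀ᶠ q : ℝ in 𝓝[>] 0, q ∈ Set.Ioo (0 : ℝ) 1 :=
  Ioo_mem_nhdsGT one_pos

lemma tendsto_RRcf_pow_five_zero : Tendsto (fun q ↦ RRcf q ^ 5) (𝓝[>] 0) (𝓝 0) := by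
  have hq : Tendsto (fun q : ℝ ↦ q) (𝓝[>] 0) (𝓝 0) := nhdsWithin_le_nhds
  have h1 := tendsto_eulerF_zero
  have h5 := tendsto_eulerF_zero.comp tendsto_pow_five_zero
  have hlim : Tendsto (fun q : ℝ ↦ q * eulerF (q ^ 5) ^ 6 / eulerF q ^ 6) (𝓝[>] 0) (𝓝 0) := by
    have h := (hq.mul (h5.pow 6)).div (h1.pow 6) (by norm_num)
    norm_num at h
    exact h
  refine tendsto_of_tendsto_of_tendsto_of_le_of_le' tendsto_const_nhds hlim
    (Eventually.of_forall fun q ↦ (pow_pos (RRcf_pos q) 5).le) ?_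
  filter_upwards [eventually_mem_Ioo] with q hq
  have p1 := eulerF_pos hq.1.le hq.2
  have p5 := eulerF_pos (pow_pos hq.1 5).le (pow_lt_one₀ hq.1.le hq.2 (by norm_num))
  have hR := RRcf_pos q
  have q0 := hq.1
  rw [le_div_iff₀ (by positivity), ← RRcf_pow_five_relation hq.1 hq.2]
  refine mul_le_of_le_one_left (by positivity) ?_
  have : 0 < RRcf q ^ 5 := by positivity
  nlinarith

lemma tendsto_rrLog : Tendsto rrLog (𝓝[>] 0) (𝓝 1) := by
  have hq : Tendsto (fun q : ℝ ↦ q) (𝓝[>] 0) (𝓝 0) := nhdsWithin_le_nhds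
  have h1 := tendsto_eulerF_zero
  have h5 := tendsto_eulerF_zero.comp tendsto_pow_five_zero
  have d1 : Tendsto (fun x : ℝ ↦ (deriv cF (x : ℂ)).re) (𝓝[>] 0) (𝓝 (deriv cF ((0 : ℝ) : ℂ)).re) :=
    (continuousAt_deriv_cF (q := 0) (by simp)).tendsto.mono_left nhdsWithin_le_nhds
  have d5 := d1.comp tendsto_pow_five_zero
  have hx := tendsto_RRcf_pow_five_zero
  have h := (((h1.pow 6).div (h5.pow 6) (by norm_num)).mul ((h5.pow 6).add
    ((((hq.pow 5).const_mul 30).mul (h5.pow 5)).mul d5)) |>.sub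
    (((hq.const_mul 6).mul (h1.pow 5)).mul d1)).div
    ((h1.pow 6).add ((((hx.const_mul 2).const_add 11).mul hq).mul (h5.pow 6))) (by norm_num)
  norm_num at h
  refine h.congr' ?_
  filter_upwards [eventually_mem_Ioo] with q hq
  rw [rrLog_eq hq.1 hq.2]
  norm_num

lemma tendsto_eulerQuot : Tendsto eulerQuot (𝓝[>] 0) (𝓝 1) := by
  have h := (tendsto_eulerF_zero.pow 5).div (tendsto_eulerF_zero.comp tendsto_pow_five_zero)
    one_ne_zero
  norm_num at h
  exact h

lemma eulerQuot_pos {q : ℝ} (h0 : 0 < q) (h1 : q < 1) : 0 < eulerQuot q :=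
  div_pos (pow_pos (eulerF_pos h0.le h1) 5)
    (eulerF_pos (pow_pos h0 5).le (pow_lt_one₀ h0.le h1 (by norm_num)))

/-- `q d/dq log R(q)⁵ = f(-q)⁵ / f(-q⁵)`. -/
theorem rrLog_eq_eulerQuot {q : ℝ} (h0 : 0 < q) (h1 : q < 1) : rrLog q = eulerQuot q := by
  have hstep : ∀ k : ℕ, rrLog (q ^ 5 ^ k) / eulerQuot (q ^ 5 ^ k) = rrLog q / eulerQuot q := by
    intro k
    induction k with
    | zero => simp
    | succ k ih =>
      rw [← ih, pow_succ, pow_mul]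
      have hu0 := pow_pos h0 (5 ^ k)
      have hu1 : q ^ 5 ^ k < 1 := pow_lt_one₀ h0.le h1 (by positivity)
      generalize q ^ 5 ^ k = u at *
      have hL := rrLog_step hu0 hu1
      have hM := eulerQuot_step hu0 hu1
      have h05 := pow_pos hu0 5
      have h15 : u ^ 5 < 1 := pow_lt_one₀ hu0.le hu1 (by norm_num)
      have hN := rrNum_pos (RRcf (u ^ 5))
      have hD := rrDen_pos (RRcf_pos (u ^ 5))
      have hs := one_sub_RRcf_sub_sq_pos h05 h15
      rw [div_eq_div_iff (eulerQuot_pos h05 h15).ne' (eulerQuot_pos hu0 hu1).ne']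
      refine mul_left_cancel₀ (mul_pos (mul_pos hN hD) (pow_pos hs 4)).ne' ?_
      linear_combination (1 - RRcf (u ^ 5) - RRcf (u ^ 5) ^ 2) ^ 4 * rrLog (u ^ 5) * hM -
        (1 - RRcf (u ^ 5) - RRcf (u ^ 5) ^ 2) ^ 4 * eulerQuot (u ^ 5) * hL
  have hlim : Tendsto (fun k : ℕ ↦ q ^ 5 ^ k) atTop (𝓝[>] 0) := by
    refine tendsto_nhdsWithin_iff.mpr ⟨?_, Eventually.of_forall fun k ↦ pow_pos h0 _⟩
    exact (tendsto_pow_atTop_nhds_zero_of_lt_one h0.le h1).comp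
      (tendsto_pow_atTop_atTop_of_one_lt (by norm_num))
  have h := ((tendsto_rrLog.div tendsto_eulerQuot one_ne_zero).comp hlim).congr
    fun k ↦ hstep k
  have := tendsto_nhds_unique h tendsto_const_nhds
  rw [div_one, eq_comm, div_eq_one_iff_eq (eulerQuot_pos h0 h1).ne'] at this
  exact this

/-- The coefficients of the binomial series of `(1 - z) ^ (-a)`. -/
noncomputable def binomCoeff (a : ℝ) (n : ℕ) : ℝ := (ascPochhammer ℝ n).eval a / n.factorial

lemma binomCoeff_nonneg {a : ℝ} (ha : 0 < a) (n : ℕ) : 0 ≤ binomCoeff a n :=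
  div_nonneg (ascPochhammer_pos n a ha).le (Nat.cast_nonneg _)

lemma hasSum_binomCoeff (a : ℝ) {z : ℝ} (hz : |z| < 1) :
    HasSum (fun n ↦ binomCoeff a n * z ^ n) (1 / (1 - z) ^ a) := by
  have h := (Real.one_div_one_sub_rpow_hasFPowerSeriesOnBall_zero a).hasSum (y := z)
    (by simpa [enorm_eq_nnnorm, ← NNReal.coe_lt_one] using hz)
  rw [zero_add] at h
  refine (congrArg (HasSum · _) (funext fun n ↦ ?_)).mpr h
  rw [FormalMultilinearSeries.ofScalars_apply_eq, ← Ring.multichoose_eq, smul_eq_mul, binomCoeff]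
  congr 1
  rw [div_eq_iff (by positivity), mul_comm, ← nsmul_eq_mul,
    Ring.factorial_nsmul_multichoose_eq_ascPochhammer, ← Polynomial.eval₂_smulOneHom_eq_smeval,
    ← ascPochhammer_map (algebraMap ℕ ℝ), Polynomial.eval_map]
  congr 1
  exact Subsingleton.elim _ _

lemma summable_binomCoeff_mul {a z w : ℝ} (ha : 0 < a) (hz : |z| < 1) (hw : |w| < 1) :
    Summable fun p : ℕ × ℕ ↦ binomCoeff a p.1 * |z| ^ p.1 * (binomCoeff a p.2 * |w| ^ p.2) :=
  (hasSum_binomCoeff a (z := |z|) (by rwa [abs_abs])).summable.mul_of_nonneg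
    (hasSum_binomCoeff a (z := |w|) (by rwa [abs_abs])).summable
    (fun n ↦ mul_nonneg (binomCoeff_nonneg ha n) (by positivity))
    (fun n ↦ mul_nonneg (binomCoeff_nonneg ha n) (by positivity))

lemma hasSum_binomCoeff_mul {a z w : ℝ} (ha : 0 < a) (hz : |z| < 1) (hw : |w| < 1) :
    HasSum (fun p : ℕ × ℕ ↦ binomCoeff a p.1 * z ^ p.1 * (binomCoeff a p.2 * w ^ p.2))
      (1 / (1 - z) ^ a * (1 / (1 - w) ^ a)) := by
  refine (hasSum_binomCoeff a hz).mul (hasSum_binomCoeff a hw) ?_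
  refine Summable.of_norm ((summable_binomCoeff_mul ha hz hw).congr fun p ↦ ?_)
  simp [abs_of_nonneg (binomCoeff_nonneg ha _)]

/-- The series `s * F₁(1/6; 1/6, 1/6; 7/6; α s⁶, β s⁶)`. -/
noncomputable def appellSeries (α β s : ℝ) : ℝ :=
  ∑' p : ℕ × ℕ, binomCoeff (1 / 6) p.1 * α ^ p.1 * (binomCoeff (1 / 6) p.2 * β ^ p.2) /
    (6 * (p.1 + p.2) + 1) * s ^ (6 * (p.1 + p.2) + 1)

lemma hasDerivAt_appellSeries {α β s : ℝ} (hα : |α| * s ^ 6 < 1) (hβ : |β| * s ^ 6 < 1) :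
    HasDerivAt (appellSeries α β)
      (1 / (1 - α * s ^ 6) ^ ((1 : ℝ) / 6) * (1 / (1 - β * s ^ 6) ^ ((1 : ℝ) / 6))) s := by
  obtain ⟨ρ, ⟨hρα, hρβ⟩, hsρ⟩ : ∃ ρ, (|α| * ρ ^ 6 < 1 ∧ |β| * ρ ^ 6 < 1) ∧ |s| < ρ := by
    have e : |s| ^ 6 = s ^ 6 := by rw [← abs_pow, abs_of_nonneg (by positivity)]
    have h1 : ∀ᶠ ρ in 𝓝 |s|, |α| * ρ ^ 6 < 1 :=
      (by fun_prop : Continuous fun ρ : ℝ ↦ |α| * ρ ^ 6).continuousAt.eventually_lt_const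
        (by beta_reduce; rwa [e])
    have h2 : ∀ᶠ ρ in 𝓝 |s|, |β| * ρ ^ 6 < 1 :=
      (by fun_prop : Continuous fun ρ : ℝ ↦ |β| * ρ ^ 6).continuousAt.eventually_lt_const
        (by beta_reduce; rwa [e])
    have h3 : ∀ᶠ ρ in 𝓝[>] |s|, |s| < ρ := self_mem_nhdsWithin
    exact (((h1.and h2).filter_mono nhdsWithin_le_nhds).and h3).exists
  have hρ0 : 0 < ρ := (abs_nonneg s).trans_lt hsρ
  have habs : ∀ γ : ℝ, |γ * ρ ^ 6| = |γ| * ρ ^ 6 := fun γ ↦ by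
    rw [abs_mul, abs_of_nonneg (by positivity : 0 ≤ ρ ^ 6)]
  have habs' : ∀ γ : ℝ, |γ * s ^ 6| = |γ| * s ^ 6 := fun γ ↦ by
    rw [abs_mul, abs_of_nonneg (by positivity : 0 ≤ s ^ 6)]
  have hpos : (0 : ℝ) < 1 / 6 := by norm_num
  have hb := binomCoeff_nonneg hpos
  have key := hasDerivAt_tsum_of_isPreconnected
    (summable_binomCoeff_mul hpos (z := α * ρ ^ 6) (w := β * ρ ^ 6) (by rwa [habs]) (by rwa [habs]))
    (g := fun p s ↦ binomCoeff (1 / 6) p.1 * α ^ p.1 * (binomCoeff (1 / 6) p.2 * β ^ p.2) /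
      (6 * (p.1 + p.2) + 1) * s ^ (6 * (p.1 + p.2) + 1))
    (g' := fun p s ↦ binomCoeff (1 / 6) p.1 * (α * s ^ 6) ^ p.1 *
      (binomCoeff (1 / 6) p.2 * (β * s ^ 6) ^ p.2))
    (t := Set.Ioo (-ρ) ρ) (y₀ := 0) (y := s) isOpen_Ioo isPreconnected_Ioo ?_ ?_ ?_ ?_ ?_
  · rw [(hasSum_binomCoeff_mul hpos (by rwa [habs']) (by rwa [habs'])).tsum_eq] at key
    exact key
  · intro p x _
    refine ((hasDerivAt_pow (6 * (p.1 + p.2) + 1) x).const_mul _).congr_deriv ?_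
    have : (6 * ((p.1 : ℝ) + p.2) + 1) ≠ 0 := by positivity
    rw [Nat.add_sub_cancel]
    push_cast
    field_simp
    ring
  · intro p x hx
    have hxρ : x ^ 6 ≤ ρ ^ 6 := by
      have := pow_le_pow_left₀ (abs_nonneg x) (abs_lt.mpr hx).le 6
      rwa [← abs_pow, abs_of_nonneg (by positivity)] at this
    have hle : ∀ (γ : ℝ) (n : ℕ), binomCoeff (1 / 6) n * |γ * x ^ 6| ^ n ≤
        binomCoeff (1 / 6) n * |γ * ρ ^ 6| ^ n := fun γ n ↦ by
      refine mul_le_mul_of_nonneg_left (pow_le_pow_left₀ (abs_nonneg _) ?_ n) (hb n)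
      rw [abs_mul, abs_mul, abs_of_nonneg (by positivity : 0 ≤ x ^ 6),
        abs_of_nonneg (by positivity : 0 ≤ ρ ^ 6)]
      exact mul_le_mul_of_nonneg_left hxρ (abs_nonneg γ)
    rw [norm_mul, norm_mul, norm_mul, norm_pow, norm_pow, Real.norm_of_nonneg (hb _),
      Real.norm_of_nonneg (hb _)]
    exact mul_le_mul (hle α p.1) (hle β p.2) (mul_nonneg (hb _) (by positivity))
      (mul_nonneg (hb _) (by positivity))
  · exact ⟨by linarith, hρ0⟩
  · exact summable_zero.congr fun p ↦ by simp
  · exact abs_lt.mp hsρ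

lemma appellSeries_zero (α β : ℝ) : appellSeries α β 0 = 0 := by
  simp [appellSeries]

lemma ascPochhammer_eval_seven_sixths (k : ℕ) :
    (ascPochhammer ℝ k).eval (7 / 6) = (6 * k + 1) * (ascPochhammer ℝ k).eval (1 / 6) := by
  induction k with
  | zero => simp
  | succ k ih =>
    rw [ascPochhammer_succ_eval, ascPochhammer_succ_eval, ih]
    push_cast
    ring

lemma mul_appellF1_eq_appellSeries (α β s : ℝ) :
    s * appellF1 (1 / 6) (1 / 6) (1 / 6) (7 / 6) (α * s ^ 6) (β * s ^ 6) =
      appellSeries α β s := by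
  rw [appellF1, appellSeries, ← tsum_mul_left]
  refine tsum_congr fun p ↦ ?_
  have h : 0 < (ascPochhammer ℝ (p.1 + p.2)).eval (1 / 6 : ℝ) :=
    ascPochhammer_pos _ _ (by norm_num)
  rw [ascPochhammer_eval_seven_sixths, binomCoeff, binomCoeff]
  have h6 : (6 * ((p.1 : ℝ) + p.2) + 1) ≠ 0 := by positivity
  push_cast
  field_simp
  ring

lemma roots_mul_bounds {x : ℝ} (hx : 0 < x) (h : 0 < 1 - 11 * x - x ^ 2) :
    |(11 - 5 * √5) / 2| * x < 1 ∧ |(11 + 5 * √5) / 2| * x < 1 := by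
  have h5 : √5 ^ 2 = 5 := Real.sq_sqrt (by norm_num)
  have h2 : 11 / 5 < √5 := Real.lt_sqrt_of_sq_lt (by norm_num)
  have hpos : 0 < 1 - (11 - 5 * √5) / 2 * x := by nlinarith
  have hβ : (11 + 5 * √5) / 2 * x < 1 := by
    have : 0 < (1 - (11 - 5 * √5) / 2 * x) * (1 - (11 + 5 * √5) / 2 * x) := by
      nlinarith
    linarith [pos_of_mul_pos_right this hpos.le]
  rw [abs_of_neg (by linarith), abs_of_pos (by linarith)]
  exact ⟨by nlinarith, hβ⟩

lemma RRcf_rpow_pow_six (q : ℝ) : (RRcf q ^ ((5 : ℝ) / 6)) ^ 6 = RRcf q ^ 5 := by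
  rw [← Real.rpow_natCast, ← Real.rpow_mul (RRcf_pos q).le, ← Real.rpow_natCast]
  norm_num

/-- The antiderivative of `f(-q)⁴ q^{-5/6}`. -/
noncomputable def eulerPrimitive (q : ℝ) : ℝ :=
  6 * appellSeries ((11 - 5 * √5) / 2) ((11 + 5 * √5) / 2) (RRcf q ^ ((5 : ℝ) / 6))

lemma hasDerivAt_eulerPrimitive {q : ℝ} (h0 : 0 < q) (h1 : q < 1) :
    HasDerivAt eulerPrimitive (eulerF q ^ 4 * q ^ (-(5 : ℝ) / 6)) q := by
  have hR := RRcf_pos q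
  have hS := one_sub_eleven_pos h0 h1
  have hb := roots_mul_bounds (pow_pos hR 5) hS
  have d := ((hasDerivAt_appellSeries (s := RRcf q ^ ((5 : ℝ) / 6))
    (by rw [RRcf_rpow_pow_six]; exact hb.1) (by rw [RRcf_rpow_pow_six]; exact hb.2)).comp q
    ((differentiableAt_RRcf h0 h1).hasDerivAt.rpow_const (Or.inl hR.ne'))).const_mul 6
  refine d.congr_deriv ?_
  rw [RRcf_rpow_pow_six]
  have h5 : √5 ^ 2 = 5 := Real.sq_sqrt (by norm_num)
  have hα1 := (abs_lt.mp (by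
    rw [abs_mul, abs_of_pos (pow_pos hR 5)]; exact hb.1 :
      |(11 - 5 * √5) / 2 * RRcf q ^ 5| < 1)).2
  have hβ1 := (abs_lt.mp (by
    rw [abs_mul, abs_of_pos (pow_pos hR 5)]; exact hb.2 :
      |(11 + 5 * √5) / 2 * RRcf q ^ 5| < 1)).2
  have hfac : (1 - (11 - 5 * √5) / 2 * RRcf q ^ 5) * (1 - (11 + 5 * √5) / 2 * RRcf q ^ 5) =
      1 - 11 * RRcf q ^ 5 - (RRcf q ^ 5) ^ 2 := by
    linear_combination (-(25 : ℝ) / 4 * (RRcf q ^ 5) ^ 2) * h5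
  rw [div_mul_div_comm, one_mul, ← Real.mul_rpow (by linarith) (by linarith), hfac]
  have p1 := eulerF_pos h0.le h1
  have p5 := eulerF_pos (pow_pos h0 5).le (pow_lt_one₀ h0.le h1 (by norm_num))
  have hL := rrLog_eq_eulerQuot h0 h1
  have hA := RRcf_pow_five_relation h0 h1
  rw [rrLog, eulerQuot, div_eq_div_iff hR.ne' p5.ne'] at hL
  have hRs : RRcf q ^ ((5 : ℝ) / 6 - 1) = RRcf q ^ ((5 : ℝ) / 6) / RRcf q := by
    rw [Real.rpow_sub hR, Real.rpow_one]
  have hqs : q ^ (-(5 : ℝ) / 6) = q ^ ((1 : ℝ) / 6) / q := by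
    rw [show -(5 : ℝ) / 6 = 1 / 6 - 1 by norm_num, Real.rpow_sub h0, Real.rpow_one]
  have hs6 := RRcf_rpow_pow_six q
  have hw6 : ((1 - 11 * RRcf q ^ 5 - (RRcf q ^ 5) ^ 2) ^ ((1 : ℝ) / 6)) ^ 6 =
      1 - 11 * RRcf q ^ 5 - (RRcf q ^ 5) ^ 2 := by
    rw [← Real.rpow_natCast, ← Real.rpow_mul hS.le]
    norm_num
  have hq6 : (q ^ ((1 : ℝ) / 6)) ^ 6 = q := by
    rw [← Real.rpow_natCast, ← Real.rpow_mul h0.le]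
    norm_num
  have hw0 := Real.rpow_pos_of_pos hS ((1 : ℝ) / 6)
  have hs0 := Real.rpow_pos_of_pos hR ((5 : ℝ) / 6)
  have hq0 := Real.rpow_pos_of_pos h0 ((1 : ℝ) / 6)
  rw [hRs, hqs]
  generalize (1 - 11 * RRcf q ^ 5 - (RRcf q ^ 5) ^ 2) ^ ((1 : ℝ) / 6) = w at *
  generalize RRcf q ^ ((5 : ℝ) / 6) = s at *
  generalize q ^ ((1 : ℝ) / 6) = v at *
  have hroot : w * (v * eulerF (q ^ 5)) = s * eulerF q := by
    refine (pow_left_inj₀ (by positivity) (by positivity) (by norm_num : (6 : ℕ) ≠ 0)).mp ?_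
    rw [mul_pow, mul_pow, mul_pow, hw6, hq6, hs6, hA]
  generalize eulerF q = f at *
  generalize eulerF (q ^ 5) = f5 at *
  generalize RRcf q = R at *
  generalize deriv RRcf q = R' at *
  have hR' : R' = f ^ 5 * R / (5 * q * f5) := by
    rw [eq_div_iff (by positivity)]
    linear_combination hL
  have hv : v = s * f / (w * f5) := by
    rw [eq_div_iff (by positivity)]
    linear_combination hroot
  rw [hR', hv]
  field_simp

lemma tendsto_eulerPrimitive_zero : Tendsto eulerPrimitive (𝓝[>] 0) (𝓝 0) := by
  have hs : Tendsto (fun q ↦ RRcf q ^ ((5 : ℝ) / 6)) (𝓝[>] 0) (𝓝 0) := by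
    have h := tendsto_RRcf_pow_five_zero.rpow_const (p := 1 / 6) (Or.inr (by norm_num))
    rw [Real.zero_rpow (by norm_num)] at h
    refine h.congr fun q ↦ ?_
    rw [← Real.rpow_natCast, ← Real.rpow_mul (RRcf_pos q).le]
    norm_num
  have hc := (hasDerivAt_appellSeries (α := (11 - 5 * √5) / 2) (β := (11 + 5 * √5) / 2)
    (s := 0) (by simp) (by simp)).continuousAt.tendsto
  rw [appellSeries_zero] at hc
  have h := (hc.comp hs).const_mul 6
  rw [mul_zero] at h
  exact h

lemma intervalIntegrable_eulerF {y : ℝ} (hy : 0 < y) (hy1 : y < 1) :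
    IntervalIntegrable (fun q ↦ eulerF q ^ 4 * q ^ (-(5 : ℝ) / 6)) volume 0 y := by
  refine (intervalIntegral.intervalIntegrable_rpow' (by norm_num)).continuousOn_mul fun q hq ↦ ?_
  rw [Set.uIcc_of_le hy.le] at hq
  have hq1 : |q| < 1 := by rw [abs_of_nonneg hq.1]; exact hq.2.trans_lt hy1
  exact ((hasDerivAt_eulerF hq1).continuousAt.pow 4).continuousWithinAt

theorem integral_f4_appell (y : ℝ) (hy : 0 < y) (hy1 : y < 1) :
    ∫ q in (0:ℝ)..y, eulerF q ^ 4 * q ^ (-(5 : ℝ) / 6) =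
      6 * RRcf y ^ ((5 : ℝ) / 6) *
        appellF1 (1 / 6) (1 / 6) (1 / 6) (7 / 6)
          (((11 - 5 * Real.sqrt 5) / 2) * RRcf y ^ 5)
          (((11 + 5 * Real.sqrt 5) / 2) * RRcf y ^ 5) := by
  have hF := intervalIntegral.integral_eq_sub_of_hasDerivAt_of_tendsto hy
    (fun q hq ↦ hasDerivAt_eulerPrimitive hq.1 (hq.2.trans hy1))
    (intervalIntegrable_eulerF hy hy1) tendsto_eulerPrimitive_zero
    ((hasDerivAt_eulerPrimitive hy hy1).continuousAt.tendsto.mono_left nhdsWithin_le_nhds)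
  rw [hF, sub_zero, eulerPrimitive, ← mul_appellF1_eq_appellSeries, RRcf_rpow_pow_six, mul_assoc]
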